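/- arXiv:2102.02610 — 13 statements merged into one kernel-verified Lean document; each statement's English description precedes it below -/
import Mathlib

section
/- Every mechanism on a discrete tree that is both onto and strategyproof is unanimous; that is, if f : V^n → V is strategyproof and onto, then for every vertex x ∈ V, f(x, x, ..., x) = x. -/
open Function

/-- `T = (V,E)` is a discrete tree: connected, acyclic, bounded degree. -/
def IsDiscreteTree {V : Type*} (G : SimpleGraph V) : Prop :=
  G.Connected ∧ G.IsAcyclic ∧
    ∃ D : ℕ, ∀ v : V, (G.neighborSet v).Finite ∧ (G.neighborSet v).ncard ≤ D

/-- `pathSet G u w` is the vertex set of the unique path `[u,w]`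
(in a tree, exactly the vertices lying on a geodesic from `u` to `w`). -/
def pathSet {V : Type*} (G : SimpleGraph V) (u w : V) : Set V :=
  {v | G.dist u v + G.dist v w = G.dist u w}

/-- `subtree G a b v` = `tree(a → b, v)`: the set of vertices reachable from `v`
via edges that do not lie on the path `[a,b]`. -/
def subtree {V : Type*} (G : SimpleGraph V) (a b v : V) : Set V :=
  {u | Relation.ReflTransGen
        (fun x y => G.Adj x y ∧ ¬(x ∈ pathSet G a b ∧ y ∈ pathSet G a b)) v u}

/-- Distance from a vertex to a set of vertices. -/
noncomputable def distToSet {V : Type*} (G : SimpleGraph V) (x : V) (S : Set V) : ℕ :=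
  sInf (G.dist x '' S)

/-- Distance between two sets of vertices. -/
noncomputable def setDist {V : Type*} (G : SimpleGraph V) (A B : Set V) : ℕ :=
  sInf {d : ℕ | ∃ u ∈ A, ∃ w ∈ B, G.dist u w = d}

/-- `depth(a → b, v)`: the distance of `v` from the path `[a,b]`. -/
noncomputable def depth {V : Type*} (G : SimpleGraph V) (a b v : V) : ℕ :=
  distToSet G v (pathSet G a b)

/-- A mechanism is strategyproof if no agent can get the facility strictly
closer to her true location by misreporting. -/
def Strategyproof {V : Type*} {n : ℕ} (G : SimpleGraph V)
    (f : (Fin n → V) → V) : Prop :=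
  ∀ (a : Fin n → V) (i : Fin n) (b : V),
    G.dist (a i) (f a) ≤ G.dist (a i) (f (Function.update a i b))

/-- Under a strategyproof mechanism, agents who move to the chosen location do not change the
outcome. -/
theorem Strategyproof.apply_piecewise_const {V : Type*} {n : ℕ} {G : SimpleGraph V}
    {f : (Fin n → V) → V} (hSP : Strategyproof G f) (hG : G.Connected) (a : Fin n → V)
    (s : Finset (Fin n)) : f (s.piecewise (fun _ => f a) a) = f a := by
  induction s using Finset.induction_on with
  | empty => simp
  | insert j s _ ih =>
    have h := hSP ((insert j s).piecewise (fun _ => f a) a) j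
      (s.piecewise (fun _ => f a) a j)
    rw [Finset.piecewise_insert, Function.update_idem, Function.update_eq_self, ih,
      Function.update_self, SimpleGraph.dist_self, Nat.le_zero, hG.dist_eq_zero_iff] at h
    rw [Finset.piecewise_insert, ← h]

/-- every onto and strategyproof mechanism on a discrete tree is
unanimous. -/
theorem onto_sp_implies_unanimous {V : Type*} {n : ℕ} (G : SimpleGraph V)
    (hT : IsDiscreteTree G) (f : (Fin n → V) → V)
    (hSP : Strategyproof G f) (hOnto : Function.Surjective f) :
    ∀ x : V, f (fun _ => x) = x := by
  intro x
  obtain ⟨a, rfl⟩ := hOnto x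
  simpa using hSP.apply_piecewise_const hT.1 a Finset.univ
end

section
/- If a mechanism f : ℝ^n → ℝ is strategyproof and unanimous, then f is uncompromising: for every profile a ∈ ℝ^n, every agent i, and every a'_i ∈ ℝ, (1) if a_i > f(a) then f(a_{-i}, a'_i) = f(a) for all a'_i ≥ f(a), and (2) if a_i < f(a) then f(a_{-i}, a'_i) = f(a) for all a'_i ≤ f(a). -/
open Function

/-- A mechanism on the continuous line is strategyproof if no agent can get the
facility strictly closer to her true location by misreporting. -/
def StrategyproofR {n : ℕ} (f : (Fin n → ℝ) → ℝ) : Prop :=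
  ∀ (a : Fin n → ℝ) (i : Fin n) (b : ℝ),
    |a i - f a| ≤ |a i - f (Function.update a i b)|

/-- Trajectory contained (TC): either the closed interval between the old and
new outcomes is contained in the closed interval between the old and new
locations of the deviating agent, or the outcome does not move. -/
def TrajectoryContainedR {n : ℕ} (f : (Fin n → ℝ) → ℝ) : Prop :=
  ∀ (a : Fin n → ℝ) (i : Fin n) (b : ℝ),
    Set.uIcc (f a) (f (Function.update a i b)) ⊆ Set.uIcc (a i) b ∨
      f a = f (Function.update a i b)

/-- Tree monotone (TMON): on the common part of the agent's trajectory and the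
facility's trajectory, the facility moves in the same direction as the agent. -/
def TreeMonotoneR {n : ℕ} (f : (Fin n → ℝ) → ℝ) : Prop :=
  ∀ (a : Fin n → ℝ) (i : Fin n) (b : ℝ),
    ∀ x ∈ Set.uIcc (a i) b ∩ Set.uIcc (f a) (f (Function.update a i b)),
      ∀ y ∈ Set.uIcc (a i) b ∩ Set.uIcc (f a) (f (Function.update a i b)),
        (|a i - x| < |a i - y| ↔ |f a - x| < |f a - y|)

/-- A one-agent strategyproof rule is nondecreasing. -/
theorem monotone_of_abs_sub_le {g : ℝ → ℝ} (hg : ∀ s t, |s - g s| ≤ |s - g t|) :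
    Monotone g := by
  intro s t hst
  by_contra! h
  have h1 := sq_le_sq.mpr (hg s t)
  have h2 := sq_le_sq.mpr (hg t s)
  rcases hst.eq_or_lt with rfl | hst
  · exact lt_irrefl _ h
  · nlinarith [mul_pos (sub_pos.mpr hst) (sub_pos.mpr h)]

/-- A one-agent strategyproof rule with `g x < x` that nowhere overshoots to the right of `x`
is constant on `[g x, ∞)`. -/
theorem eq_of_lt_of_forall_le {g : ℝ → ℝ} (hg : ∀ s t, |s - g s| ≤ |s - g t|)
    {x : ℝ} (hx : g x < x) (hle : ∀ y, x ≤ y → g y ≤ y) {b : ℝ} (hb : g x ≤ b) :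
    g b = g x := by
  have hmono := monotone_of_abs_sub_le hg
  by_contra hne
  have hgb : g x < g b := by
    rcases le_total b x with hbx | hbx
    · have h1 := hmono hbx
      have h2 := hg b x
      rw [abs_of_nonneg (by linarith : 0 ≤ b - g b), abs_of_nonneg (by linarith)] at h2
      exact absurd (le_antisymm h1 (by linarith)) hne
    · exact lt_of_le_of_ne (hmono hbx) (Ne.symm hne)
  have hfar : ∀ t, g x < g t → 2 * x - g x ≤ g t := by
    intro t ht
    have h := hg x t
    rw [abs_of_pos (by linarith : 0 < x - g x)] at h
    rcases le_abs.mp h with h | h <;> linarith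
  let R : Set ℝ := {r | g x < r ∧ ∃ t, g t = r}
  have hRne : R.Nonempty := ⟨g b, hgb, b, rfl⟩
  have hRbdd : BddBelow R := ⟨g x, fun r hr => hr.1.le⟩
  set q := sInf R
  have hq : 2 * x - g x ≤ q := by
    refine le_csInf hRne ?_
    rintro r ⟨hr, t, rfl⟩
    exact hfar t hr
  have hgt : g ((x + q) / 2) < q := by
    have := hle ((x + q) / 2) (by linarith)
    linarith
  -- The midpoint of `x` and `q` is closer to range points near `q` than to `g x`.
  obtain ⟨r, hr, hrt⟩ := exists_lt_of_csInf_lt hRne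
    (show sInf R < q + (x - g x) / 2 by change q < _; linarith)
  have hqr : q ≤ r := csInf_le hRbdd hr
  obtain ⟨-, t, rfl⟩ := hr
  have h := hg ((x + q) / 2) t
  have hlow : g x < g ((x + q) / 2) := by
    have hqt : |(x + q) / 2 - g t| < (x + q) / 2 - g x := by
      rw [abs_lt]
      constructor <;> linarith
    have := le_abs_self ((x + q) / 2 - g ((x + q) / 2))
    linarith
  have : q ≤ g ((x + q) / 2) := csInf_le hRbdd ⟨hlow, _, rfl⟩
  linarith

/-- Mirror image of `eq_of_lt_of_forall_le`. -/
theorem eq_of_gt_of_forall_ge {g : ℝ → ℝ} (hg : ∀ s t, |s - g s| ≤ |s - g t|)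
    {x : ℝ} (hx : x < g x) (hle : ∀ y, y ≤ x → y ≤ g y) {b : ℝ} (hb : b ≤ g x) :
    g b = g x := by
  have h := eq_of_lt_of_forall_le (g := fun t => -g (-t)) (x := -x) (b := -b)
    (fun s t => by
      have h := hg (-s) (-t)
      rw [← abs_neg, ← abs_neg (-s - g (-t))] at h
      convert h using 2 <;> ring)
    (by simpa using hx)
    (fun y hy => by have := hle (-y) (by linarith); linarith)
    (by simpa using hb)
  simpa using h

section Coalition

variable {n : ℕ} {f : (Fin n → ℝ) → ℝ}

/-- The profile in which all members of `S` report `t` and the others report as in `a`. -/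
def coalitionMove (S : Finset (Fin n)) (a : Fin n → ℝ) (t : ℝ) : Fin n → ℝ :=
  fun j => if j ∈ S then t else a j

theorem StrategyproofR.monotone (hSP : StrategyproofR f) : Monotone f := by
  have hstep : ∀ (a : Fin n → ℝ) (i : Fin n) (c : ℝ), a i ≤ c → f a ≤ f (update a i c) := by
    intro a i c hc
    have h := monotone_of_abs_sub_le (g := fun t => f (update a i t))
      (fun s t => by simpa using hSP (update a i s) i t) hc
    simpa using h
  intro a b hab
  have key : ∀ T : Finset (Fin n), f a ≤ f (T.piecewise b a) := by
    intro T
    induction T using Finset.induction_on with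
    | empty => simp
    | insert i T hi ih =>
      rw [Finset.piecewise_insert]
      exact ih.trans (hstep _ i _ (by simpa [hi] using hab i))
  simpa using key Finset.univ

/-- A coalition with a common location cannot gain by a common misreport. -/
theorem StrategyproofR.coalition (hSP : StrategyproofR f) (S : Finset (Fin n))
    (a : Fin n → ℝ) (s t : ℝ) :
    |s - f (coalitionMove S a s)| ≤ |s - f (coalitionMove S a t)| := by
  have key : ∀ T : Finset (Fin n), T ⊆ S → |s - f (coalitionMove S a s)| ≤
      |s - f (T.piecewise (coalitionMove S a t) (coalitionMove S a s))| := by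
    intro T
    induction T using Finset.induction_on with
    | empty => simp
    | insert i T hi ih =>
      intro hT
      rw [Finset.insert_subset_iff] at hT
      rw [Finset.piecewise_insert]
      refine (ih hT.2).trans ?_
      simpa [hi, coalitionMove, hT.1] using
        hSP (T.piecewise (coalitionMove S a t) (coalitionMove S a s)) i (coalitionMove S a t i)
  have hS : S.piecewise (coalitionMove S a t) (coalitionMove S a s) = coalitionMove S a t := by
    ext j
    by_cases hj : j ∈ S <;> simp [hj, coalitionMove]
  simpa [hS] using key S subset_rfl

/-- A coalition with a common location cannot face both an outcome to its left and, from a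
location further right, an outcome to its right. -/
theorem StrategyproofR.coalition_not_overshoot (hSP : StrategyproofR f)
    (hU : ∀ x : ℝ, f (fun _ => x) = x) (S : Finset (Fin n)) (a : Fin n → ℝ) {x y : ℝ}
    (hxy : x ≤ y) (hx : f (coalitionMove S a x) < x) : f (coalitionMove S a y) ≤ y := by
  induction hk : Sᶜ.card using Nat.strong_induction_on generalizing S a x y with
  | _ k ih =>
  subst hk
  by_contra! hy
  have hmono := hSP.monotone
  obtain ⟨i, hiS, hi⟩ : ∃ i ∉ S, a i ≤ x := by
    by_contra! hall
    have : f (fun _ => x) ≤ f (coalitionMove S a x) := hmono fun j => by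
      by_cases hj : j ∈ S
      · simp [coalitionMove, hj]
      · simpa [coalitionMove, hj] using (hall j hj).le
    rw [hU] at this
    linarith
  obtain ⟨l, hlS, hl⟩ : ∃ l ∉ S, x < a l := by
    by_contra! hall
    have : f (coalitionMove S a y) ≤ f (fun _ => y) := hmono fun j => by
      by_cases hj : j ∈ S
      · simp [coalitionMove, hj]
      · simpa [coalitionMove, hj] using (hall j hj).trans hxy
    rw [hU] at this
    linarith
  set A := S ∪ Finset.univ.filter (fun j => a j ≤ x)
  set B := S ∪ Finset.univ.filter (fun j => x < a j)
  have hA : Aᶜ.card < Sᶜ.card := Finset.card_lt_card <| by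
    rw [Finset.compl_ssubset_compl]
    exact Finset.ssubset_iff_subset_ne.mpr
      ⟨Finset.subset_union_left, fun h => hiS (h ▸ by simp [A, hi])⟩
  have hB : Bᶜ.card < Sᶜ.card := Finset.card_lt_card <| by
    rw [Finset.compl_ssubset_compl]
    exact Finset.ssubset_iff_subset_ne.mpr
      ⟨Finset.subset_union_left, fun h => hlS (h ▸ by simp [B, hl])⟩
  have hQ : y < f (coalitionMove A a y) := hy.trans_le <| hmono fun j => by
    by_cases hj : j ∈ S
    · simp [coalitionMove, A, hj]
    · by_cases hjx : a j ≤ x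
      · simpa [coalitionMove, A, hj, hjx] using hjx.trans hxy
      · simp [coalitionMove, A, hj, hjx]
  have hP : f (coalitionMove B a x) < x := lt_of_le_of_lt (hmono fun j => by
    by_cases hj : j ∈ S
    · simp [coalitionMove, B, hj]
    · by_cases hjx : x < a j
      · simpa [coalitionMove, B, hj, hjx] using hjx.le
      · simp [coalitionMove, B, hj, hjx]) hx
  set M := ∑ j, |a j| + |x| + |y|
  have hM : ∀ j, |a j| ≤ M := fun j => by
    have := Finset.single_le_sum (fun j _ => abs_nonneg (a j)) (Finset.mem_univ j)
    linarith [abs_nonneg x, abs_nonneg y]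
  have hsum : 0 ≤ ∑ j, |a j| := Finset.sum_nonneg fun j _ => abs_nonneg _
  have hlow : f (coalitionMove A a (-M)) = f (coalitionMove A a y) :=
    eq_of_gt_of_forall_ge (g := fun t => f (coalitionMove A a t)) (hSP.coalition A a) hQ
      (fun z hz => by
        by_contra! hlt
        exact absurd (ih _ hA A a hz hlt rfl) (not_le.mpr hQ))
      (by linarith [neg_abs_le y, abs_nonneg x])
  have hhigh : f (coalitionMove B a M) = f (coalitionMove B a x) :=
    eq_of_lt_of_forall_le (g := fun t => f (coalitionMove B a t)) (hSP.coalition B a) hP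
      (fun z hz => ih _ hB B a hz hP rfl)
      (by linarith [le_abs_self x, abs_nonneg y])
  have hle : f (coalitionMove A a (-M)) ≤ f (coalitionMove B a M) := hmono fun j => by
    have hj := abs_le.mp (hM j)
    unfold coalitionMove
    split_ifs with h1 h2 h2
    · linarith
    · exact hj.1
    · exact hj.2
    · exact le_rfl
  linarith

end Coalition

/-- a strategyproof and unanimous mechanism on the real line is
uncompromising. -/
theorem sp_unanimous_implies_uncompromising {n : ℕ} (f : (Fin n → ℝ) → ℝ)
    (hSP : StrategyproofR f) (hU : ∀ x : ℝ, f (fun _ => x) = x) :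
    ∀ (a : Fin n → ℝ) (i : Fin n) (b : ℝ),
      (a i > f a → b ≥ f a → f (Function.update a i b) = f a) ∧
      (a i < f a → b ≤ f a → f (Function.update a i b) = f a) := by
  intro a i b
  have hmove : ∀ t, coalitionMove {i} a t = update a i t := fun t => by
    ext j
    by_cases hj : j = i
    · subst hj
      simp [coalitionMove]
    · simp [coalitionMove, hj]
  have hself : f (coalitionMove {i} a (a i)) = f a := by simp [hmove]
  rw [← hmove, ← hself]
  refine ⟨fun ha hb => ?_, fun ha hb => ?_⟩
  · exact eq_of_lt_of_forall_le (g := fun t => f (coalitionMove {i} a t))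
      (hSP.coalition {i} a) ha
      (fun z hz => hSP.coalition_not_overshoot hU {i} a hz ha) hb
  · exact eq_of_gt_of_forall_ge (g := fun t => f (coalitionMove {i} a t))
      (hSP.coalition {i} a) ha
      (fun z hz => by
        by_contra! hlt
        exact absurd (hSP.coalition_not_overshoot hU {i} a hz hlt) (not_le.mpr ha)) hb
end

section
/- Every onto and strategyproof mechanism f : ℝ^n → ℝ on the continuous line is trajectory contained (TC): for every profile a, every agent i, and every a'_i ∈ ℝ, letting a' = (a_{-i}, a'_i), either the closed interval between f(a) and f(a') is contained in the closed interval between a_i and a'_i, or f(a) = f(a'). -/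
open Function

/-- Agent `i`, the others being fixed as in `a`, makes the outcome jump from `p` to `q` at their
midpoint. -/
def IsJump {n : ℕ} (f : (Fin n → ℝ) → ℝ) (a : Fin n → ℝ) (i : Fin n) (p q : ℝ) : Prop :=
  p < q ∧ (∀ x, p < x → x < (p + q) / 2 → f (update a i x) = p) ∧
    ∀ x, (p + q) / 2 < x → x < q → f (update a i x) = q

namespace StrategyproofR

variable {n : ℕ} {f : (Fin n → ℝ) → ℝ}

theorem update_le (hSP : StrategyproofR f) (a : Fin n → ℝ) (i : Fin n) (x y : ℝ) :
    |x - f (update a i x)| ≤ |x - f (update a i y)| := by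
  simpa using hSP (update a i x) i y

/-- Agents sharing the location `p` cannot profit from a joint misreport. -/
theorem coalition_le (hSP : StrategyproofR f) {a b : Fin n → ℝ} {p : ℝ}
    (h : ∀ k, b k = a k ∨ a k = p) : |p - f a| ≤ |p - f b| := by
  have key : ∀ s : Finset (Fin n), |p - f a| ≤ |p - f (s.piecewise b a)| := by
    intro s
    induction s using Finset.induction_on with
    | empty => simp
    | insert j s hj ih =>
      rw [Finset.piecewise_insert]
      have hval : s.piecewise b a j = a j := Finset.piecewise_eq_of_notMem _ _ _ hj
      rcases h j with h | h
      · rwa [h, ← hval, update_eq_self]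
      · have := hSP (s.piecewise b a) j (b j)
        rw [hval, h] at this
        exact ih.trans this
  simpa using key Finset.univ

theorem const (hSP : StrategyproofR f) (hOnto : Surjective f) (c : ℝ) :
    f (fun _ => c) = c := by
  obtain ⟨b, hb⟩ := hOnto c
  have := hSP.coalition_le (a := fun _ => c) (b := b) (p := c) (fun _ => Or.inr rfl)
  rw [hb, sub_self, abs_zero] at this
  linarith [abs_nonpos_iff.1 this]

/-- Moving the other agents to the nearer of `p` and `q` preserves the two outcomes. -/
theorem piecewise_eq (hSP : StrategyproofR f) {a : Fin n → ℝ} {i : Fin n} {p q l r : ℝ}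
    (hpq : p < q) (hpr : p < r) (hlq : l < q) (hl : f (update a i l) = p) (hr : f (update a i r) = q)
    (ha : ∀ k, k ≠ i → a k ≠ (p + q) / 2) (s : Finset (Fin n)) :
    f (update (s.piecewise (fun k => if a k < (p + q) / 2 then p else q) a) i l) = p ∧
      f (update (s.piecewise (fun k => if a k < (p + q) / 2 then p else q) a) i r) = q := by
  induction s using Finset.induction_on with
  | empty => simpa using ⟨hl, hr⟩
  | insert j s hj ih =>
    rw [Finset.piecewise_insert]
    have hval : s.piecewise (fun k => if a k < (p + q) / 2 then p else q) a j = a j :=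
      Finset.piecewise_eq_of_notMem _ _ _ hj
    set c := s.piecewise (fun k => if a k < (p + q) / 2 then p else q) a
    by_cases hji : j = i
    · subst hji
      simpa using ih
    have step (x t : ℝ) :
        |a j - f (update c i x)| ≤ |a j - f (update (update c j t) i x)| ∧
          |t - f (update (update c j t) i x)| ≤ |t - f (update c i x)| := by
      have h1 := hSP.update_le (update c i x) j (a j) t
      have h2 := hSP.update_le (update c i x) j t (a j)
      have e : update (update c i x) j (a j) = update c i x := by
        rw [update_eq_self_iff, update_of_ne hji, hval]
      rw [e] at h1 h2
      rw [update_comm hji]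
      exact ⟨h1, h2⟩
    have hne := ha j hji
    obtain ⟨il, ir⟩ := ih
    have hL := step l
    have hR := step r
    rw [il] at hL
    rw [ir] at hR
    split_ifs with hlt
    · have hLp : f (update (update c j p) i l) = p := by
        have := (hL p).2
        rw [sub_self, abs_zero] at this
        linarith [abs_nonpos_iff.1 this]
      refine ⟨hLp, ?_⟩
      have hmono := hSP.update_le (update c j p) i r l
      rw [hLp] at hmono
      have := hR p
      clear hL hR step hLp
      generalize f (update (update c j p) i r) = w at *
      grind
    · have hRq : f (update (update c j q) i r) = q := by
        have := (hR q).2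
        rw [sub_self, abs_zero] at this
        linarith [abs_nonpos_iff.1 this]
      refine ⟨?_, hRq⟩
      have hmono := hSP.update_le (update c j q) i l r
      rw [hRq] at hmono
      have := hL q
      clear hL hR step hRq
      generalize f (update (update c j q) i l) = w at *
      grind

theorem not_isJump_of_ne (hSP : StrategyproofR f) (hOnto : Surjective f) {a : Fin n → ℝ}
    {i : Fin n} {p q : ℝ} (ha : ∀ k, k ≠ i → a k ≠ (p + q) / 2) : ¬ IsJump f a i p q := by
  rintro ⟨hpq, hlow, hhigh⟩
  obtain ⟨l, hl⟩ : ∃ l, l = (p + q) / 2 - (q - p) / 12 := ⟨_, rfl⟩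
  obtain ⟨r, hr⟩ : ∃ r, r = (p + q) / 2 + (q - p) / 12 := ⟨_, rfl⟩
  obtain ⟨hl', hr'⟩ := hSP.piecewise_eq hpq (by linarith) (by linarith) (hlow l (by linarith) (by linarith))
    (hhigh r (by linarith) (by linarith)) ha Finset.univ
  rw [Finset.piecewise_univ] at hl' hr'
  let L : Fin n → Prop := fun k => k ≠ i ∧ a k < (p + q) / 2
  classical
  let F : ℝ → ℝ → Fin n → ℝ := fun y t k => if L k then y else t
  have hlow1 := hSP.coalition_le (p := l) (a := F p l)
    (b := update (fun k => if a k < (p + q) / 2 then p else q) i l) (by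
      intro k; by_cases hk : k = i <;> simp [F, L, hk]; grind)
  have hlow2 := hSP.coalition_le (p := q) (b := F p l)
    (a := update (fun k => if a k < (p + q) / 2 then p else q) i l) (by
      intro k; by_cases hk : k = i <;> simp [F, L, hk]; grind)
  have hhigh1 := hSP.coalition_le (p := r) (a := F p r)
    (b := update (fun k => if a k < (p + q) / 2 then p else q) i r) (by
      intro k; by_cases hk : k = i <;> simp [F, L, hk]; grind)
  have hmerge := hSP.coalition_le (p := p) (a := F p r) (b := fun _ => r) (by
      intro k; simp only [F]; grind)
  have hcross := hSP.coalition_le (p := l) (a := F p l) (b := F p r) (by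
      intro k; simp only [F]; grind)
  rw [hl'] at hlow1 hlow2
  rw [hr'] at hhigh1
  rw [hSP.const hOnto] at hmerge
  have hpl : f (F p l) = p := by grind
  rw [hpl] at hcross
  grind

theorem not_isJump (hSP : StrategyproofR f) (hOnto : Surjective f) (a : Fin n → ℝ)
    (i : Fin n) (p q : ℝ) : ¬ IsJump f a i p q := by
  classical
  induction hN : (Finset.univ.filter fun k => a k = (p + q) / 2).card
    using Nat.strong_induction_on generalizing a i with
  | _ N ih =>
  subst hN
  by_cases hex : ∃ k, k ≠ i ∧ a k = (p + q) / 2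
  swap
  · push Not at hex
    exact hSP.not_isJump_of_ne hOnto hex
  obtain ⟨k, hki, hk⟩ := hex
  rintro ⟨hpq, hlow, hhigh⟩
  have hself (x : ℝ) : update (update a i x) k ((p + q) / 2) = update a i x := by
    rw [update_eq_self_iff, update_of_ne hki, hk]
  have step (x t : ℝ) := hSP.update_le (update a i x) k ((p + q) / 2) t
  have step' (x t : ℝ) := hSP.update_le (update a i x) k t ((p + q) / 2)
  simp only [hself] at step step'
  have hq (x : ℝ) (h1 : (p + q) / 2 < x) (h2 : x < q) :
      f (update (update a i x) k q) = q := by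
    have := step' x q
    rw [hhigh x h1 h2] at this
    grind
  by_cases hall : ∀ x, p < x → x < (p + q) / 2 → f (update (update a i x) k q) = p
  · refine ih _ (Finset.card_lt_card ?_) (update a k q) i rfl
      ⟨hpq, ?_, ?_⟩
    · rw [Finset.ssubset_iff_of_subset]
      · exact ⟨k, by simp [hk], by simp; grind⟩
      · intro j
        by_cases hj : j = k <;> simp [hj, hk]
    · simpa only [update_comm hki] using hall
    · simpa only [update_comm hki] using hq
  · push Not at hall
    obtain ⟨x, hx1, hx2, hx⟩ := hall
    have hxq : f (update (update a i x) k q) = q := by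
      have h1 := step x q
      have h2 := step' x q
      have h3 := hSP.update_le (update a k q) i x ((p + 3 * q) / 4)
      rw [update_comm hki, update_comm hki,
        hq ((p + 3 * q) / 4) (by linarith) (by linarith)] at h3
      rw [hlow x hx1 hx2] at h1 h2
      grind
    refine ih _ (Finset.card_lt_card ?_) (update (update a i x) k p) k rfl
      ⟨hpq, ?_, ?_⟩
    · rw [Finset.ssubset_iff_of_subset]
      · exact ⟨k, by simp [hk], by simp; grind⟩
      · intro j
        by_cases hj : j = k
        · simp [hj, hk]
        · by_cases hj' : j = i
          · subst hj'
            simp [hj, hx2.ne]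
          · simp [hj, hj']
    · intro y h1 h2
      rw [update_idem]
      have := step x y
      have := step' x y
      rw [hlow x hx1 hx2] at *
      grind
    · intro y h1 h2
      rw [update_idem]
      have h3 := step x y
      have h4 := hSP.update_le (update a i x) k y q
      rw [hxq] at h4
      rw [hlow x hx1 hx2] at h3
      grind

/-- The outcomes an agent can bring about form an interval, on which she is decisive. -/
theorem update_eq_self_of_mem_Icc (hSP : StrategyproofR f) (hOnto : Surjective f)
    (a : Fin n → ℝ) (i : Fin n) {x y c : ℝ}
    (hc : c ∈ Set.Icc (f (update a i x)) (f (update a i y))) : f (update a i c) = c := by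
  set g : ℝ → ℝ := fun x => f (update a i x)
  have hSP' : ∀ x y, |x - g x| ≤ |x - g y| := hSP.update_le a i
  have hclosure : ∀ z ∈ closure (Set.range g), g z = z := by
    intro z hz
    by_contra hne
    obtain ⟨_, ⟨w, rfl⟩, hw⟩ :=
      Metric.mem_closure_iff.1 hz |z - g z| (abs_pos.2 (sub_ne_zero.2 (Ne.symm hne)))
    rw [Real.dist_eq] at hw
    exact absurd (hSP' z w) (not_le.2 hw)
  by_contra hne
  change g c ≠ c at hne
  have hbdd : BddAbove (Set.range g ∩ Set.Iic c) := ⟨c, fun _ h => h.2⟩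
  have hbdd' : BddBelow (Set.range g ∩ Set.Ici c) := ⟨c, fun _ h => h.2⟩
  have hnon : (Set.range g ∩ Set.Iic c).Nonempty := ⟨g x, ⟨x, rfl⟩, hc.1⟩
  have hnon' : (Set.range g ∩ Set.Ici c).Nonempty := ⟨g y, ⟨y, rfl⟩, hc.2⟩
  obtain ⟨p, hp⟩ : ∃ p, p = sSup (Set.range g ∩ Set.Iic c) := ⟨_, rfl⟩
  obtain ⟨q, hq⟩ : ∃ q, q = sInf (Set.range g ∩ Set.Ici c) := ⟨_, rfl⟩
  have hgp : g p = p := hclosure p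
    (closure_mono Set.inter_subset_left (hp ▸ csSup_mem_closure hnon hbdd))
  have hgq : g q = q := hclosure q
    (closure_mono Set.inter_subset_left (hq ▸ csInf_mem_closure hnon' hbdd'))
  have hpc : p ≤ c := hp ▸ csSup_le hnon fun _ h => h.2
  have hcq : c ≤ q := hq ▸ le_csInf hnon' fun _ h => h.2
  have hgap (z : ℝ) : g z ≤ p ∨ q ≤ g z := by
    rcases le_total (g z) c with h | h
    · exact Or.inl (hp ▸ le_csSup hbdd ⟨⟨z, rfl⟩, h⟩)
    · exact Or.inr (hq ▸ csInf_le hbdd' ⟨⟨z, rfl⟩, h⟩)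
  have hpc' : p < c := lt_of_le_of_ne hpc (by rintro rfl; exact hne hgp)
  refine hSP.not_isJump hOnto a i p q ⟨hpc'.trans_le hcq, ?_, ?_⟩
  · intro z h1 h2
    change g z = p
    have := hgap z
    have := hSP' z p
    grind
  · intro z h1 h2
    change g z = q
    have := hgap z
    have := hSP' z q
    grind

/-- When an agent moves the outcome to the right, her own move covers that of the outcome. -/
theorem le_and_le_of_lt (hSP : StrategyproofR f) (hOnto : Surjective f) (a : Fin n → ℝ)
    (i : Fin n) {x y : ℝ} (h : f (update a i x) < f (update a i y)) :
    x ≤ f (update a i x) ∧ f (update a i y) ≤ y := by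
  have hx := hSP.update_le a i x y
  have hy := hSP.update_le a i y x
  constructor
  · by_contra! hlt
    have := hSP.update_eq_self_of_mem_Icc hOnto a i (c := x) (x := x) (y := y)
      ⟨hlt.le, by grind⟩
    linarith
  · by_contra! hlt
    have := hSP.update_eq_self_of_mem_Icc hOnto a i (c := y) (x := x) (y := y)
      ⟨by grind, hlt.le⟩
    linarith

end StrategyproofR

/-- every onto and strategyproof mechanism on the continuous line
is trajectory contained. -/
theorem onto_sp_implies_tc {n : ℕ} (f : (Fin n → ℝ) → ℝ)
    (hOnto : Function.Surjective f) (hSP : StrategyproofR f) :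
    TrajectoryContainedR f := by
  intro a i b
  rcases lt_trichotomy (f a) (f (update a i b)) with h | h | h
  · have := hSP.le_and_le_of_lt hOnto a i (x := a i) (y := b) (by simpa using h)
    rw [update_eq_self] at this
    left
    rw [Set.uIcc_of_le h.le, Set.uIcc_of_le (by linarith)]
    exact Set.Icc_subset_Icc this.1 this.2
  · exact Or.inr h
  · have := hSP.le_and_le_of_lt hOnto a i (x := b) (y := a i) (by simpa using h)
    rw [update_eq_self] at this
    left
    rw [Set.uIcc_of_ge h.le, Set.uIcc_of_ge (by linarith)]
    exact Set.Icc_subset_Icc this.1 this.2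
end

section
/- Every strategyproof mechanism f : ℝ^n → ℝ on the continuous line is tree monotone (TMON): for every profile a, every agent i, every a'_i ∈ ℝ, and all points x, y lying in the intersection of the closed interval between a_i and a'_i with the closed interval between f(a) and f(a') (where a' = (a_{-i}, a'_i)), it holds that |a_i − x| < |a_i − y| if and only if |f(a) − x| < |f(a) − y|. -/
open Function

/-- If each of `u`, `v` is weakly the preferred outcome at `p`, `q` respectively,
then the outcome moves weakly in the same direction as the location. -/
theorem le_of_abs_sub_le_of_lt {p q u v : ℝ} (hpq : p < q) (hp : |p - u| ≤ |p - v|)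
    (hq : |q - v| ≤ |q - u|) : u ≤ v := by
  by_contra! h
  rw [← sq_le_sq] at hp hq
  nlinarith [mul_pos (sub_pos.2 hpq) (sub_pos.2 h)]

/-- Distances to the left endpoints of two intervals order their common points alike. -/
theorem abs_sub_lt_iff_of_le {p u x y : ℝ} (hpx : p ≤ x) (hpy : p ≤ y) (hux : u ≤ x)
    (huy : u ≤ y) : |p - x| < |p - y| ↔ |u - x| < |u - y| := by
  simp only [abs_sub_comm p, abs_sub_comm u, abs_of_nonneg (sub_nonneg.2 hpx),
    abs_of_nonneg (sub_nonneg.2 hpy), abs_of_nonneg (sub_nonneg.2 hux),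
    abs_of_nonneg (sub_nonneg.2 huy), sub_lt_sub_iff_right]

/-- Distances to the right endpoints of two intervals order their common points alike. -/
theorem abs_sub_lt_iff_of_ge {p u x y : ℝ} (hpx : x ≤ p) (hpy : y ≤ p) (hux : x ≤ u)
    (huy : y ≤ u) : |p - x| < |p - y| ↔ |u - x| < |u - y| := by
  simp only [abs_of_nonneg (sub_nonneg.2 hpx), abs_of_nonneg (sub_nonneg.2 hpy),
    abs_of_nonneg (sub_nonneg.2 hux), abs_of_nonneg (sub_nonneg.2 huy), sub_lt_sub_iff_left]

/-- every strategyproof mechanism on the continuous line is tree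
monotone. -/
theorem sp_implies_tmon {n : ℕ} (f : (Fin n → ℝ) → ℝ)
    (hSP : StrategyproofR f) :
    TreeMonotoneR f := by
  rintro a i b x ⟨hx, hx'⟩ y ⟨hy, hy'⟩
  have hp := hSP a i b
  have hq : |b - f (update a i b)| ≤ |b - f a| := by
    simpa using hSP (update a i b) i (a i)
  rcases lt_trichotomy (a i) b with h | h | h
  · have huv := le_of_abs_sub_le_of_lt h hp hq
    rw [Set.uIcc_of_le h.le] at hx hy
    rw [Set.uIcc_of_le huv] at hx' hy'
    exact abs_sub_lt_iff_of_le hx.1 hy.1 hx'.1 hy'.1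
  · rw [← h, Set.uIcc_self, Set.mem_singleton_iff] at hx hy
    simp [hx, hy]
  · have hvu := le_of_abs_sub_le_of_lt h hq hp
    rw [Set.uIcc_of_ge h.le] at hx hy
    rw [Set.uIcc_of_ge hvu] at hx' hy'
    exact abs_sub_lt_iff_of_ge hx.2 hy.2 hx'.2 hy'.2
end

section
/- Every mechanism f : ℝ^n → ℝ on the continuous line that is both trajectory contained (TC) and tree monotone (TMON) is strategyproof. -/
open Function

/-- every TC and TMON mechanism on the continuous line is
strategyproof. -/
theorem tc_tmon_implies_sp {n : ℕ} (f : (Fin n → ℝ) → ℝ)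
    (hTC : TrajectoryContainedR f) (hTMON : TreeMonotoneR f) :
    StrategyproofR f := by
  intro a i b
  by_cases h : f a = f (Function.update a i b)
  · rw [← h]
  · have hsub := (hTC a i b).resolve_right h
    have hmove : |f a - f a| < |f a - f (Function.update a i b)| := by
      rw [sub_self, abs_zero]
      exact abs_pos.mpr (sub_ne_zero.mpr h)
    exact ((hTMON a i b _ ⟨hsub Set.left_mem_uIcc, Set.left_mem_uIcc⟩
      _ ⟨hsub Set.right_mem_uIcc, Set.right_mem_uIcc⟩).mpr hmove).le
end

section
/- An onto mechanism f : ℝ^n → ℝ on the continuous line is strategyproof if and only if it is tree monotone (TMON) and trajectory contained (TC). -/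
open Function

/-- A property of profiles that survives replacing one coordinate of `a` by the corresponding
coordinate of `b` passes from `a` to `b`. -/
lemma induction_update {n : ℕ} (a b : Fin n → ℝ) (P : (Fin n → ℝ) → Prop) (ha : P a)
    (h : ∀ c j, c j = a j → P c → P (update c j (b j))) : P b := by
  have key : ∀ s : Finset (Fin n), P (s.piecewise b a) := by
    intro s
    induction s using Finset.induction_on with
    | empty => simpa using ha
    | insert j s hj ih =>
      rw [Finset.piecewise_insert]
      exact h _ j (Finset.piecewise_eq_of_notMem s b a hj) ih
  simpa using key Finset.univ

namespace StrategyproofR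

variable {n : ℕ} {f : (Fin n → ℝ) → ℝ}

lemma abs_sub_update_le (hf : StrategyproofR f) (a : Fin n → ℝ) (i : Fin n) (s t : ℝ) :
    |s - f (update a i s)| ≤ |s - f (update a i t)| := by
  simpa using hf (update a i s) i t

lemma update_le_update (hf : StrategyproofR f) (a : Fin n → ℝ) (i : Fin n) {s t : ℝ}
    (hst : s ≤ t) : f (update a i s) ≤ f (update a i t) := by
  rcases hst.eq_or_lt with rfl | hlt
  · rfl
  have h₁ := sq_le_sq.2 (hf.abs_sub_update_le a i s t)
  have h₂ := sq_le_sq.2 (hf.abs_sub_update_le a i t s)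
  by_contra! h
  nlinarith

lemma monotone_s5 (hf : StrategyproofR f) : Monotone f := by
  intro a b hab
  refine induction_update a b (fun c => f a ≤ f c) le_rfl fun c j hj hc => hc.trans ?_
  simpa using hf.update_le_update c j (hj.trans_le (hab j))

lemma apply_const (hf : StrategyproofR f) (hOnto : Surjective f) (x : ℝ) :
    f (fun _ => x) = x := by
  obtain ⟨a, ha⟩ := hOnto x
  refine induction_update a (fun _ => x) (fun c => f c = x) ha fun c j _ hc => ?_
  have h := hf.abs_sub_update_le c j x (c j)
  rw [update_eq_self, hc, sub_self, abs_zero] at h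
  linarith [abs_nonpos_iff.1 h]

lemma neg (hf : StrategyproofR f) : StrategyproofR fun a => -f (-a) := by
  intro a i b
  have h := hf (-a) i (-b)
  have e : update (-a) i (-b) = -update a i b := by
    ext j
    by_cases hj : j = i
    · subst hj; simp
    · simp [hj]
  rw [e, ← abs_neg, ← abs_neg ((-a) i - f (-update a i b))] at h
  convert h using 2 <;> simp only [Pi.neg_apply] <;> ring

end StrategyproofR

/-- Agent `i`, facing the reports `c` of the others, can obtain `l` and `u` but nothing strictly
in between. -/
def HasOptionGap {n : ℕ} (f : (Fin n → ℝ) → ℝ) (i : Fin n) (l u : ℝ) (c : Fin n → ℝ) : Prop :=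
  (∀ t, l < t → t < (l + u) / 2 → f (update c i t) = l) ∧
    ∀ t, (l + u) / 2 < t → t < u → f (update c i t) = u

namespace StrategyproofR

variable {n : ℕ} {f : (Fin n → ℝ) → ℝ}

/-- An option gap persists when an agent moves from the left of it into its left half. -/
lemma hasOptionGap_update (hf : StrategyproofR f) {i j : Fin n} {l u w : ℝ} {c : Fin n → ℝ}
    (hlw : l < w) (hwu : w < (l + u) / 2) (hc : HasOptionGap f i l u c) (hj : c j ≤ l) :
    HasOptionGap f i l u (update c j w) := by
  by_cases hji : j = i
  · subst hji
    simpa [HasOptionGap] using hc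
  have hmono : ∀ t, f (update c i t) ≤ f (update (update c j w) i t) := by
    intro t
    apply hf.monotone_s5
    rw [update_le_update_iff]
    exact ⟨le_rfl, fun k _ => le_update_iff.2 ⟨hj.trans hlw.le, fun _ _ => le_rfl⟩ k⟩
  have hclose : ∀ t, |w - f (update (update c j w) i t)| ≤ |w - f (update c i t)| := by
    intro t
    have h := hf.abs_sub_update_le (update c i t) j w (c j)
    rw [update_comm (Ne.symm hji), update_comm (Ne.symm hji), update_eq_self] at h
    exact h
  have hright : ∀ t, (l + u) / 2 < t → t < u → f (update (update c j w) i t) = u := by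
    intro t h₁ h₂
    have h₃ := hmono t
    have h₄ := hclose t
    rw [hc.2 t h₁ h₂] at h₃ h₄
    rw [abs_of_nonpos (by linarith : w - u ≤ 0)] at h₄
    linarith [neg_le_of_abs_le h₄]
  refine ⟨fun t h₁ h₂ => ?_, hright⟩
  have h₃ := hmono t
  have h₄ := hclose t
  rw [hc.1 t h₁ h₂] at h₃ h₄
  rw [abs_of_pos (by linarith : 0 < w - l)] at h₄
  have h₅ := neg_le_of_abs_le h₄
  refine le_antisymm ?_ h₃
  by_contra! h
  set v := f (update (update c j w) i t) with hv
  obtain ⟨s, hs₁, hs₂⟩ := exists_between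
    (lt_min (by linarith : (l + u) / 2 < (v + u) / 2) (by linarith : (l + u) / 2 < u))
  rw [lt_min_iff] at hs₂
  have h₆ := hf.abs_sub_update_le (update c j w) i s t
  rw [hright s hs₁ hs₂.2, ← hv, ← sq_le_sq] at h₆
  nlinarith [hs₂.1]

lemma not_hasOptionGap (hf : StrategyproofR f) (hOnto : Surjective f) {i : Fin n} {l u : ℝ}
    (hlu : l < u) (c : Fin n → ℝ) : ¬ HasOptionGap f i l u c := by
  intro hc
  obtain ⟨w, hlw, hwu⟩ := exists_between (by linarith : l < (l + u) / 2)
  set b : Fin n → ℝ := fun j => if c j ≤ l then w else c j with hb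
  have hgap : HasOptionGap f i l u b := by
    refine induction_update c b _ hc fun d j hj hd => ?_
    by_cases h : c j ≤ l
    · simpa [hb, h] using hf.hasOptionGap_update hlw hwu hd (hj.trans_le h)
    · rwa [show b j = d j by simp only [hb, if_neg h, hj], update_eq_self]
  have hlt : ∀ j, l < update b i w j := by
    intro j
    by_cases hj : j = i
    · subst hj; simpa
    · by_cases h : c j ≤ l
      · simpa [hj, hb, h]
      · simpa only [update_of_ne hj, hb, if_neg h] using not_le.1 h
  have : Nonempty (Fin n) := ⟨i⟩
  obtain ⟨k, hk⟩ := Finite.exists_min (update b i w)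
  have h := hf.monotone_s5 (show (fun _ => update b i w k) ≤ update b i w from hk)
  rw [hf.apply_const hOnto, hgap.1 w hlw hwu] at h
  exact (hlt k).not_ge h

/-- An agent who can pull the outcome to the right by moving right was not to the right of it. -/
lemma le_of_lt_update (hf : StrategyproofR f) (hOnto : Surjective f) {a : Fin n → ℝ} {i : Fin n}
    {b : ℝ} (h : f a < f (update a i b)) : a i ≤ f a := by
  by_contra! hlt
  set l := f a with hl
  set U : Set ℝ := {v | l < v ∧ ∃ t, f (update a i t) = v} with hU
  have hne : U.Nonempty := ⟨_, h, b, rfl⟩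
  have hbound : ∀ v ∈ U, 2 * a i - l ≤ v := by
    rintro v ⟨hv, t, rfl⟩
    have h₁ := hf a i t
    rw [← hl, ← sq_le_sq] at h₁
    nlinarith
  have hbdd : BddBelow U := ⟨_, hbound⟩
  have hu : 2 * a i - l ≤ sInf U := le_csInf hne hbound
  set u := sInf U with hu_def
  have hgap : ∀ t, l < f (update a i t) → u ≤ f (update a i t) := fun t ht =>
    csInf_le hbdd ⟨ht, t, rfl⟩
  refine hf.not_hasOptionGap hOnto (i := i) (l := l) (u := u) (by linarith) a ⟨?_, ?_⟩
  · intro t h₁ h₂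
    have h₃ := hf.abs_sub_update_le a i t (a i)
    rw [update_eq_self, ← hl, abs_of_pos (by linarith : 0 < t - l), abs_le] at h₃
    refine le_antisymm ?_ (by linarith)
    by_contra! h₄
    linarith [hgap t h₄]
  · intro t h₁ h₂
    have h₃ : f (update a i t) ≤ u := by
      refine le_csInf hne ?_
      rintro v ⟨hv, s, rfl⟩
      have h₄ := hf.abs_sub_update_le a i t s
      have h₅ := hgap s hv
      rw [abs_of_nonpos (by linarith : t - f (update a i s) ≤ 0)] at h₄
      linarith [neg_le_of_abs_le h₄]
    refine le_antisymm h₃ (hgap t ?_)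
    obtain ⟨v, ⟨hv, s, rfl⟩, hv₂⟩ := exists_lt_of_csInf_lt hne (by linarith : sInf U < 2 * t - l)
    have h₄ := hf.abs_sub_update_le a i t s
    rw [← sq_le_sq] at h₄
    by_contra! h₅
    nlinarith

lemma update_le_of_lt (hf : StrategyproofR f) (hOnto : Surjective f) {a : Fin n → ℝ} {i : Fin n}
    {b : ℝ} (h : f a < f (update a i b)) : f (update a i b) ≤ b := by
  have hOnto' : Surjective fun a => -f (-a) :=
    neg_surjective.comp (hOnto.comp neg_surjective)
  have key := hf.neg.le_of_lt_update hOnto' (a := -update a i b) (i := i) (b := -a i) (by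
    have e : -update (-update a i b) i (-a i) = a := by
      ext j
      by_cases hj : j = i
      · subst hj; simp
      · simp [hj]
    simp only [e, neg_neg]
    linarith)
  simpa using key

lemma le_and_update_le (hf : StrategyproofR f) (hOnto : Surjective f) {a : Fin n → ℝ} {i : Fin n}
    {b : ℝ} (h : f a ≠ f (update a i b)) :
    (a i ≤ f a ∧ f a < f (update a i b) ∧ f (update a i b) ≤ b) ∨
      (b ≤ f (update a i b) ∧ f (update a i b) < f a ∧ f a ≤ a i) := by
  rcases h.lt_or_gt with h | h
  · exact .inl ⟨hf.le_of_lt_update hOnto h, h, hf.update_le_of_lt hOnto h⟩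
  · have h' : f (update a i b) < f (update (update a i b) i (a i)) := by simpa using h
    have h₁ := hf.le_of_lt_update hOnto h'
    have h₂ := hf.update_le_of_lt hOnto h'
    simp only [update_self, update_idem, update_eq_self] at h₁ h₂
    exact .inr ⟨h₁, h, h₂⟩

end StrategyproofR

lemma TreeMonotoneR.strategyproofR {n : ℕ} {f : (Fin n → ℝ) → ℝ} (hm : TreeMonotoneR f)
    (hc : TrajectoryContainedR f) : StrategyproofR f := by
  intro a i b
  rcases hc a i b with h | h
  · by_cases he : f a = f (update a i b)
    · rw [← he]
    · have hx := Set.left_mem_uIcc (a := f a) (b := f (update a i b))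
      have hy := Set.right_mem_uIcc (a := f a) (b := f (update a i b))
      refine ((hm a i b _ ⟨h hx, hx⟩ _ ⟨h hy, hy⟩).2 ?_).le
      simpa [sub_eq_zero] using he
  · rw [← h]

lemma StrategyproofR.trajectoryContainedR {n : ℕ} {f : (Fin n → ℝ) → ℝ} (hf : StrategyproofR f)
    (hOnto : Surjective f) : TrajectoryContainedR f := by
  intro a i b
  by_cases he : f a = f (update a i b)
  · exact .inr he
  refine .inl ?_
  rw [Set.uIcc_subset_uIcc_iff_mem, Set.mem_uIcc, Set.mem_uIcc]
  rcases hf.le_and_update_le hOnto he with ⟨h₁, h₂, h₃⟩ | ⟨h₁, h₂, h₃⟩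
  · exact ⟨.inl ⟨h₁, by linarith⟩, .inl ⟨by linarith, h₃⟩⟩
  · exact ⟨.inr ⟨by linarith, h₃⟩, .inr ⟨h₁, by linarith⟩⟩

lemma StrategyproofR.treeMonotoneR {n : ℕ} {f : (Fin n → ℝ) → ℝ} (hf : StrategyproofR f)
    (hOnto : Surjective f) : TreeMonotoneR f := by
  rintro a i b x ⟨-, hx⟩ y ⟨-, hy⟩
  by_cases he : f a = f (update a i b)
  · rw [← he, Set.uIcc_self, Set.mem_singleton_iff] at hx hy
    simp [hx, hy]
  rcases hf.le_and_update_le hOnto he with ⟨h₁, h₂, h₃⟩ | ⟨h₁, h₂, h₃⟩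
  · rw [Set.uIcc_of_le h₂.le, Set.mem_Icc] at hx hy
    rw [abs_of_nonpos (by linarith : a i - x ≤ 0), abs_of_nonpos (by linarith : a i - y ≤ 0),
      abs_of_nonpos (by linarith : f a - x ≤ 0), abs_of_nonpos (by linarith : f a - y ≤ 0)]
    constructor <;> intro <;> linarith
  · rw [Set.uIcc_of_ge h₂.le, Set.mem_Icc] at hx hy
    rw [abs_of_nonneg (by linarith : 0 ≤ a i - x), abs_of_nonneg (by linarith : 0 ≤ a i - y),
      abs_of_nonneg (by linarith : 0 ≤ f a - x), abs_of_nonneg (by linarith : 0 ≤ f a - y)]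
    constructor <;> intro <;> linarith

/-- an onto mechanism on the continuous line is strategyproof if
and only if it is tree monotone and trajectory contained. -/
theorem onto_sp_iff_tmon_tc {n : ℕ} (f : (Fin n → ℝ) → ℝ)
    (hOnto : Function.Surjective f) :
    StrategyproofR f ↔ (TreeMonotoneR f ∧ TrajectoryContainedR f) := by
  exact ⟨fun hf => ⟨hf.treeMonotoneR hOnto, hf.trajectoryContainedR hOnto⟩,
    fun h => h.1.strategyproofR h.2⟩
end

section
/- Let f be a mechanism on a discrete tree, and let a and a' = (a_{-i}, a'_i) be two profiles differing only in agent i's location. Then the pair (a, a') violates strategyproofness (i.e., d(a_i, f(a)) > d(a_i, f(a')) or d(a'_i, f(a')) > d(a'_i, f(a))) if and only if the pair violates the depth-balanced condition or the tree-monotonicity condition; that is, it fails d(tree(a_i → a'_i, f(a)), tree(a_i → a'_i, f(a'))) ≥ |depth(a_i → a'_i, f(a)) − depth(a_i → a'_i, f(a'))|, or it fails that for all vertices x, y lying both on the path [a_i, a'_i] and on the path [f(a), f(a')], d(a_i, x) < d(a_i, y) ⇔ d(f(a), x) < d(f(a), y). -/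
open Function

namespace SimpleGraph

variable {V : Type*} {G : SimpleGraph V}

theorem mem_pathSet {u w v : V} :
    v ∈ pathSet G u w ↔ G.dist u v + G.dist v w = G.dist u w := Iff.rfl

theorem mem_pathSet_comm {u w v : V} : v ∈ pathSet G u w ↔ v ∈ pathSet G w u := by
  simp only [mem_pathSet, G.dist_comm (u := w)]
  rw [add_comm, G.dist_comm (u := v), G.dist_comm (u := v)]

theorem left_mem_pathSet (u w : V) : u ∈ pathSet G u w := by
  simp [mem_pathSet]

theorem right_mem_pathSet (u w : V) : w ∈ pathSet G u w := by
  simp [mem_pathSet]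

theorem IsTree.length_eq_dist_of_isPath (hG : G.IsTree) {u v : V} {p : G.Walk u v}
    (hp : p.IsPath) : p.length = G.dist u v := by
  obtain ⟨q, hq, hql⟩ := hG.connected.exists_path_of_dist u v
  have h : (⟨p, hp⟩ : G.Path u v) = ⟨q, hq⟩ := (hG.isAcyclic.subsingleton_path _ _).elim _ _
  rw [← hql, congrArg (fun r : G.Path u v => r.1.length) h]

theorem IsTree.mem_support_of_mem_pathSet (hG : G.IsTree) {u v z : V} {p : G.Walk u v}
    (hp : p.IsPath) (hz : z ∈ pathSet G u v) : z ∈ p.support := by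
  obtain ⟨q, -, hql⟩ := hG.connected.exists_path_of_dist u z
  obtain ⟨r, -, hrl⟩ := hG.connected.exists_path_of_dist z v
  have hqr : (q.append r).IsPath := Walk.isPath_of_length_eq_dist _ (by
    rw [Walk.length_append, hql, hrl]; exact hz)
  have h : (⟨p, hp⟩ : G.Path u v) = ⟨q.append r, hqr⟩ :=
    (hG.isAcyclic.subsingleton_path _ _).elim _ _
  have h' : p = q.append r := congrArg Subtype.val h
  rw [h', Walk.mem_support_append_iff]
  exact .inl q.end_mem_support

theorem mem_pathSet_of_mem_support (hG : G.Connected) {u v z : V} {p : G.Walk u v}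
    (hp : p.length = G.dist u v) (hz : z ∈ p.support) : z ∈ pathSet G u v := by
  obtain ⟨q, r, rfl⟩ := Walk.mem_support_iff_exists_append.mp hz
  have h₁ := G.dist_le q
  have h₂ := G.dist_le r
  have h₃ := hG.dist_triangle (u := u) (v := z) (w := v)
  rw [Walk.length_append] at hp
  rw [mem_pathSet]
  omega

theorem IsTree.mem_pathSet_or_mem_pathSet (hG : G.IsTree) {a b m z : V}
    (hm : m ∈ pathSet G a b) (hz : z ∈ pathSet G a b) :
    z ∈ pathSet G a m ∨ z ∈ pathSet G m b := by
  obtain ⟨q, -, hql⟩ := hG.connected.exists_path_of_dist a m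
  obtain ⟨r, -, hrl⟩ := hG.connected.exists_path_of_dist m b
  have hqr : (q.append r).IsPath := Walk.isPath_of_length_eq_dist _ (by
    rw [Walk.length_append, hql, hrl]; exact hm)
  have h := hG.mem_support_of_mem_pathSet hqr hz
  rw [Walk.mem_support_append_iff] at h
  exact h.imp (mem_pathSet_of_mem_support hG.connected hql)
    (mem_pathSet_of_mem_support hG.connected hrl)

/-- `p` is the gate (nearest-point projection) of `v` on the path `[a,b]`. -/
def IsGate (G : SimpleGraph V) (a b v p : V) : Prop :=
  p ∈ pathSet G a b ∧ ∀ z ∈ pathSet G a b, G.dist v z = G.dist v p + G.dist p z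

theorem IsTree.dist_left_of_forall_dist_le (hG : G.IsTree) {a b v m : V}
    (hm : m ∈ pathSet G a b) (hmin : ∀ z ∈ pathSet G a b, G.dist v m ≤ G.dist v z) :
    G.dist v a = G.dist v m + G.dist m a := by
  obtain ⟨q, hq, hql⟩ := hG.connected.exists_path_of_dist v m
  obtain ⟨r, hr, hrl⟩ := hG.connected.exists_path_of_dist m a
  have hqr : (q.append r).IsPath := by
    rw [Walk.isPath_def, Walk.support_append, List.nodup_append']
    refine ⟨hq.support_nodup, hr.support_nodup.tail, fun x hxq hxr => ?_⟩
    have hx₁ := mem_pathSet_of_mem_support hG.connected hql hxq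
    have hx₂ := mem_pathSet_of_mem_support hG.connected hrl (List.mem_of_mem_tail hxr)
    have hxm : x = m := by
      have hxab : x ∈ pathSet G a b := by
        have h₁ := hG.connected.dist_triangle (u := a) (v := x) (w := b)
        have h₂ := hG.connected.dist_triangle (u := x) (v := m) (w := b)
        rw [mem_pathSet] at *
        rw [G.dist_comm (u := m) (v := a), G.dist_comm (u := m) (v := x),
          G.dist_comm (u := x) (v := a)] at hx₂
        omega
      have h := hmin x hxab
      rw [mem_pathSet] at hx₁
      exact hG.connected.dist_eq_zero_iff.mp (by omega)
    subst hxm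
    have hnd := hr.support_nodup
    rw [← Walk.cons_tail_support, List.nodup_cons] at hnd
    exact hnd.1 hxr
  rw [← hG.length_eq_dist_of_isPath hqr, Walk.length_append, hql, hrl]

theorem IsTree.exists_isGate (hG : G.IsTree) (a b v : V) : ∃ p, IsGate G a b v p := by
  obtain ⟨m, hm, hmin⟩ := exists_minimalFor_of_wellFoundedLT (· ∈ pathSet G a b) (G.dist v)
    ⟨a, left_mem_pathSet a b⟩
  have hmin' : ∀ z ∈ pathSet G a b, G.dist v m ≤ G.dist v z := fun z hz =>
    (le_total _ _).elim id (hmin hz)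
  have ha := hG.dist_left_of_forall_dist_le hm hmin'
  have hb := hG.dist_left_of_forall_dist_le (a := b) (b := a) (mem_pathSet_comm.mp hm)
    fun z hz => hmin' z (mem_pathSet_comm.mp hz)
  refine ⟨m, hm, fun z hz => ?_⟩
  have h₁ := hG.connected.dist_triangle (u := v) (v := m) (w := z)
  have h₂ := hG.connected.dist_triangle (u := v) (v := z) (w := a)
  have h₃ := hG.connected.dist_triangle (u := v) (v := z) (w := b)
  rcases hG.mem_pathSet_or_mem_pathSet hm hz with h | h <;> rw [mem_pathSet] at h <;>
    grind [G.dist_comm]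

theorem IsTree.eq_of_mem_pathSet_of_dist_eq (hG : G.IsTree) {a b p q : V}
    (hp : p ∈ pathSet G a b) (hq : q ∈ pathSet G a b) (h : G.dist a p = G.dist a q) :
    p = q := by
  refine hG.connected.dist_eq_zero_iff.mp ?_
  rcases hG.mem_pathSet_or_mem_pathSet hp hq with h' | h' <;> rw [mem_pathSet] at * <;>
    grind [G.dist_comm]

theorem depth_eq_of_isGate {a b v p : V} (hp : IsGate G a b v p) :
    depth G a b v = G.dist v p := by
  refine le_antisymm (Nat.sInf_le ⟨p, hp.1, rfl⟩) ?_
  refine le_csInf ⟨_, p, hp.1, rfl⟩ ?_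
  rintro _ ⟨z, hz, rfl⟩
  rw [hp.2 z hz]
  exact Nat.le_add_right _ _

theorem IsTree.isGate_of_adj (hG : G.IsTree) {a b x y p : V} (hp : IsGate G a b x p)
    (hadj : G.Adj x y) (hxy : ¬(x ∈ pathSet G a b ∧ y ∈ pathSet G a b)) :
    IsGate G a b y p := by
  obtain ⟨p', hp'⟩ := hG.exists_isGate a b y
  suffices h : p = p' by rwa [h]
  by_contra hne
  have hpos := hG.connected.pos_dist_of_ne hne
  have h₁ := hp.2 p' hp'.1
  have h₂ := hp'.2 p hp.1
  have hd : G.dist x y = 1 := dist_eq_one_iff_adj.mpr hadj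
  have h₃ := hG.connected.dist_triangle (u := x) (v := y) (w := p')
  have h₄ := hG.connected.dist_triangle (u := y) (v := x) (w := p)
  rw [G.dist_comm (u := p') (v := p)] at h₂
  rw [G.dist_comm (u := y) (v := x)] at h₄
  have hx : x ∈ pathSet G y p := by
    rw [mem_pathSet, G.dist_comm (u := y) (v := x)]; omega
  have hpy : p' ∈ pathSet G y p := by
    rw [mem_pathSet, G.dist_comm (u := p') (v := p)]; omega
  rcases hG.mem_pathSet_or_mem_pathSet hx hpy with h | h <;> rw [mem_pathSet] at h
  · rw [G.dist_comm (u := p') (v := x), G.dist_comm (u := y) (v := x)] at h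
    have hxp : x = p := hG.connected.dist_eq_zero_iff.mp (by omega)
    have hyp : y = p' := hG.connected.dist_eq_zero_iff.mp (by omega)
    exact hxy ⟨hxp ▸ hp.1, hyp ▸ hp'.1⟩
  · omega

theorem IsTree.isGate_of_mem_subtree (hG : G.IsTree) {a b u v p : V} (hp : IsGate G a b v p)
    (hu : u ∈ subtree G a b v) : IsGate G a b u p := by
  induction hu with
  | refl => exact hp
  | tail _ h ih => exact hG.isGate_of_adj ih h.1 h.2

theorem IsTree.gate_mem_subtree (hG : G.IsTree) {a b v p : V} (hp : IsGate G a b v p) :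
    p ∈ subtree G a b v := by
  obtain ⟨w, hw⟩ := hG.connected.exists_walk_length_eq_dist v p
  induction w with
  | nil => exact .refl
  | @cons v x p h w ih =>
    have hle := G.dist_le w
    have htri := hG.connected.dist_triangle (u := v) (v := x) (w := p)
    rw [dist_eq_one_iff_adj.mpr h] at htri
    rw [Walk.length_cons] at hw
    have hv : ¬(v ∈ pathSet G a b ∧ x ∈ pathSet G a b) := fun hv => by
      have h := hp.2 v hv.1
      rw [dist_self] at h
      omega
    exact .head ⟨h, hv⟩ (ih (hG.isGate_of_adj hp h hv) (by omega))

theorem IsTree.dist_eq_of_isGate (hG : G.IsTree) {a b u w p q : V} (hp : IsGate G a b u p)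
    (hq : IsGate G a b w q) (hne : p ≠ q) :
    G.dist u w = G.dist u p + G.dist p q + G.dist q w := by
  obtain ⟨m, hm, hgate⟩ := hG.exists_isGate u q w
  have hpos := hG.connected.pos_dist_of_ne hne
  have h₁ := hp.2 q hq.1
  have h₂ := hq.2 p hp.1
  have hpu : p ∈ pathSet G u q := h₁.symm
  have h₃ := hgate p hpu
  have h₄ := hgate q (right_mem_pathSet u q)
  have h₅ := hgate u (left_mem_pathSet u q)
  rcases hG.mem_pathSet_or_mem_pathSet hpu hm with h | h <;> rw [mem_pathSet] at h hm <;>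
    grind [G.dist_comm]

theorem IsTree.setDist_subtree_eq (hG : G.IsTree) {a b u w p q : V} (hp : IsGate G a b u p)
    (hq : IsGate G a b w q) :
    setDist G (subtree G a b u) (subtree G a b w) = G.dist p q := by
  have hmem : G.dist p q ∈ {d : ℕ | ∃ x ∈ subtree G a b u, ∃ y ∈ subtree G a b w,
      G.dist x y = d} := ⟨p, hG.gate_mem_subtree hp, q, hG.gate_mem_subtree hq, rfl⟩
  refine le_antisymm (Nat.sInf_le hmem) (le_csInf ⟨_, hmem⟩ ?_)
  rintro _ ⟨x, hx, y, hy, rfl⟩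
  by_cases hne : p = q
  · simp [hne]
  · have h := hG.dist_eq_of_isGate (hG.isGate_of_mem_subtree hp hx)
      (hG.isGate_of_mem_subtree hq hy) hne
    omega

/-- Tree-monotonicity, phrased through the gates of the two outcomes. -/
theorem IsTree.tmon_iff (hG : G.IsTree) {a b u w p q : V} (hp : IsGate G a b u p)
    (hq : IsGate G a b w q) :
    (∀ x ∈ pathSet G a b ∩ pathSet G u w, ∀ y ∈ pathSet G a b ∩ pathSet G u w,
      (G.dist a x < G.dist a y ↔ G.dist u x < G.dist u y)) ↔
      G.dist a p ≤ G.dist a q := by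
  by_cases hne : p = q
  · subst hne
    have heq : ∀ x ∈ pathSet G a b ∩ pathSet G u w, p = x := by
      rintro x ⟨hx, hxuw⟩
      have h₁ := hp.2 x hx
      have h₂ := hq.2 x hx
      have h₃ := hG.connected.dist_triangle (u := u) (v := p) (w := w)
      rw [mem_pathSet, G.dist_comm (u := x)] at hxuw
      rw [G.dist_comm (u := p) (v := w)] at h₃
      exact hG.connected.dist_eq_zero_iff.mp (by omega)
    refine ⟨fun _ => le_rfl, fun _ x hx y hy => ?_⟩
    rw [← heq x hx, ← heq y hy]
    simp
  have hpos := hG.connected.pos_dist_of_ne hne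
  have huw := hG.dist_eq_of_isGate hp hq hne
  have hpq := hp.2 q hq.1
  have hqp := hq.2 p hp.1
  constructor
  · intro h
    have hp' : p ∈ pathSet G u w := by rw [mem_pathSet]; grind [G.dist_comm]
    have hq' : q ∈ pathSet G u w := by rw [mem_pathSet]; grind [G.dist_comm]
    exact ((h p ⟨hp.1, hp'⟩ q ⟨hq.1, hq'⟩).mpr (by omega)).le
  · intro hle
    have hlt : G.dist a p + G.dist p q = G.dist a q := by
      have h₁ := hp.1
      have h₂ := hq.1
      rcases hG.mem_pathSet_or_mem_pathSet hp.1 hq.1 with h | h <;>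
        rw [mem_pathSet] at * <;> grind [G.dist_comm]
    have key : ∀ x ∈ pathSet G a b ∩ pathSet G u w,
        G.dist a x = G.dist a p + G.dist p x ∧ G.dist u x = G.dist u p + G.dist p x := by
      rintro x ⟨hx, hxuw⟩
      have h₁ := hp.2 x hx
      have h₂ := hq.2 x hx
      have h₃ := hG.connected.dist_triangle (u := a) (v := p) (w := x)
      have h₄ := hG.connected.dist_triangle (u := a) (v := x) (w := q)
      rw [mem_pathSet] at hxuw
      rw [G.dist_comm (u := x) (v := w)] at hxuw
      rw [G.dist_comm (u := x) (v := q)] at h₄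
      rw [G.dist_comm (u := q) (v := w)] at huw
      exact ⟨by omega, h₁⟩
    intro x hx y hy
    have h₁ := key x hx
    have h₂ := key y hy
    omega

/-- On a path, distances to one endpoint determine all distances. -/
theorem IsTree.dist_eq_abs_sub (hG : G.IsTree) {a b p q : V} (hp : p ∈ pathSet G a b)
    (hq : q ∈ pathSet G a b) : (G.dist p q : ℤ) = |(G.dist a p : ℤ) - G.dist a q| := by
  rcases hG.mem_pathSet_or_mem_pathSet hp hq with h | h <;> rw [mem_pathSet] at * <;>
    grind [G.dist_comm]

theorem IsTree.violates_sp_iff (hG : G.IsTree) (a b u w : V) :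
    (G.dist a u > G.dist a w ∨ G.dist b w > G.dist b u) ↔
      (¬ ((setDist G (subtree G a b u) (subtree G a b w) : ℤ) ≥
          |(depth G a b u : ℤ) - (depth G a b w : ℤ)|) ∨
       ¬ (∀ x ∈ pathSet G a b ∩ pathSet G u w, ∀ y ∈ pathSet G a b ∩ pathSet G u w,
          (G.dist a x < G.dist a y ↔ G.dist u x < G.dist u y))) := by
  obtain ⟨p, hp⟩ := hG.exists_isGate a b u
  obtain ⟨q, hq⟩ := hG.exists_isGate a b w
  rw [hG.tmon_iff hp hq, hG.setDist_subtree_eq hp hq, depth_eq_of_isGate hp,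
    depth_eq_of_isGate hq, hG.dist_eq_abs_sub hp.1 hq.1]
  have hua := hp.2 a (left_mem_pathSet a b)
  have hub := hp.2 b (right_mem_pathSet a b)
  have hwa := hq.2 a (left_mem_pathSet a b)
  have hwb := hq.2 b (right_mem_pathSet a b)
  have hpab := mem_pathSet.mp hp.1
  have hqab := mem_pathSet.mp hq.1
  rw [G.dist_comm (u := a) (v := u), G.dist_comm (u := a) (v := w),
    G.dist_comm (u := b) (v := u), G.dist_comm (u := b) (v := w), hua, hub, hwa, hwb,
    G.dist_comm (u := p) (v := a), G.dist_comm (u := q) (v := a)]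
  grind

end SimpleGraph

/-- a pair of profiles differing in one agent's location violates
strategyproofness iff it violates depth-balancedness (DB) or
tree-monotonicity (TMON). -/
theorem pair_violates_sp_iff_violates_db_or_tmon {V : Type*} {n : ℕ}
    (G : SimpleGraph V) (hT : IsDiscreteTree G) (f : (Fin n → V) → V)
    (a : Fin n → V) (i : Fin n) (b : V) :
    (G.dist (a i) (f a) > G.dist (a i) (f (Function.update a i b)) ∨
     G.dist b (f (Function.update a i b)) > G.dist b (f a)) ↔
    (¬ ((setDist G (subtree G (a i) b (f a))
          (subtree G (a i) b (f (Function.update a i b))) : ℤ) ≥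
        |(depth G (a i) b (f a) : ℤ) -
          (depth G (a i) b (f (Function.update a i b)) : ℤ)|) ∨
     ¬ (∀ x ∈ pathSet G (a i) b ∩ pathSet G (f a) (f (Function.update a i b)),
          ∀ y ∈ pathSet G (a i) b ∩ pathSet G (f a) (f (Function.update a i b)),
            (G.dist (a i) x < G.dist (a i) y ↔
             G.dist (f a) x < G.dist (f a) y))) := by
  exact SimpleGraph.IsTree.violates_sp_iff ⟨hT.1, hT.2.1⟩ _ _ _ _
end

section
/- Every onto, strategyproof mechanism f on a discrete tree is almost depth restricted (ADR): for every profile a, agent i, and a'_i ∈ V such that f(a) ≠ f(a_{-i}, a'_i) and tree(a_i → a'_i, f(a)) = tree(a_i → a'_i, f(a_{-i}, a'_i)), letting z be the unique vertex in [a_i, f(a)] ∩ [a_i, f(a_{-i}, a'_i)] ∩ [f(a), f(a_{-i}, a'_i)], it holds that d(f(a), z) = d(f(a_{-i}, a'_i), z) and d(f(a), z) = 1. -/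
open Function

/-- Almost depth restricted (ADR): whenever a single agent's deviation moves
the facility within the same tree (w.r.t. the move), the old and new outcomes
are both at distance exactly 1 from the meeting point `z` of the three paths. -/
def ADR {V : Type*} {n : ℕ} (G : SimpleGraph V) (f : (Fin n → V) → V) : Prop :=
  ∀ (a : Fin n → V) (i : Fin n) (b : V),
    f a ≠ f (Function.update a i b) →
    subtree G (a i) b (f a) = subtree G (a i) b (f (Function.update a i b)) →
    ∀ z ∈ pathSet G (a i) (f a) ∩ pathSet G (a i) (f (Function.update a i b)) ∩
            pathSet G (f a) (f (Function.update a i b)),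
      G.dist (f a) z = G.dist (f (Function.update a i b)) z ∧
      G.dist (f a) z = 1

namespace IsDiscreteTree

variable {V : Type*} {G : SimpleGraph V}

theorem dist_triangle (hT : IsDiscreteTree G) (u v w : V) :
    G.dist u w ≤ G.dist u v + G.dist v w :=
  hT.1.dist_triangle

/-- A vertex of `[u, w]` separates any third vertex from `u` or from `w`. -/
theorem mem_pathSet_or_mem_pathSet (hT : IsDiscreteTree G) {u w z : V}
    (hz : z ∈ pathSet G u w) (v : V) : z ∈ pathSet G u v ∨ z ∈ pathSet G v w := by
  classical
  have mem_of_support : ∀ {s t : V} (p : G.Walk s t), p.length = G.dist s t →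
      z ∈ p.support → z ∈ pathSet G s t := by
    intro s t p hp hzp
    have h := congrArg SimpleGraph.Walk.length (p.take_spec hzp)
    rw [SimpleGraph.Walk.length_append] at h
    have h1 := SimpleGraph.dist_le (p.takeUntil z hzp)
    have h2 := SimpleGraph.dist_le (p.dropUntil z hzp)
    have h3 := hT.dist_triangle s z t
    change G.dist s z + G.dist z t = G.dist s t
    omega
  obtain ⟨p, hp⟩ := hT.1.exists_walk_length_eq_dist u z
  obtain ⟨q, hq⟩ := hT.1.exists_walk_length_eq_dist z w
  obtain ⟨r, hr⟩ := hT.1.exists_walk_length_eq_dist u v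
  obtain ⟨s, hs⟩ := hT.1.exists_walk_length_eq_dist v w
  have hpq : (p.append q).IsPath := by
    apply SimpleGraph.Walk.isPath_of_length_eq_dist
    rw [SimpleGraph.Walk.length_append, hp, hq]
    exact hz
  have heq := congrArg Subtype.val
    ((hT.2.1.subsingleton_path u w).elim ⟨_, hpq⟩ ⟨_, (r.append s).bypass_isPath⟩)
  have hmem : z ∈ (p.append q).support := by
    rw [SimpleGraph.Walk.mem_support_append_iff]
    exact Or.inl p.end_mem_support
  change p.append q = (r.append s).bypass at heq
  rw [heq] at hmem
  have := (r.append s).support_bypass_subset_support hmem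
  rw [SimpleGraph.Walk.mem_support_append_iff] at this
  exact this.imp (mem_of_support r hr) (mem_of_support s hs)

theorem pathSet_symm {u w z : V} (hz : z ∈ pathSet G u w) : z ∈ pathSet G w u := by
  change _ + _ = _ at hz ⊢
  rw [G.dist_comm (u := w) (v := z), G.dist_comm (u := z) (v := u),
    G.dist_comm (u := w) (v := u)]
  omega

/-- Along an edge off `[a, b]` the distances to `a` and to `b` change by the same amount. -/
theorem dist_add_dist_of_adj (hT : IsDiscreteTree G) {a b u v : V} (hadj : G.Adj u v)
    (hoff : ¬(u ∈ pathSet G a b ∧ v ∈ pathSet G a b)) :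
    G.dist a u + G.dist b v = G.dist a v + G.dist b u := by
  have hne := fun c => (SimpleGraph.IsTree.mk hT.1 hT.2.1).dist_ne_of_adj c hadj
  have huv := SimpleGraph.dist_eq_one_iff_adj.2 hadj
  have hvu := SimpleGraph.dist_eq_one_iff_adj.2 hadj.symm
  have not_opposite : ∀ {s t : V}, ¬(s ∈ pathSet G a b ∧ t ∈ pathSet G a b) →
      G.dist s t = 1 → G.dist t s = 1 →
      ¬(G.dist a t = G.dist a s + 1 ∧ G.dist b s = G.dist b t + 1) := by
    rintro s t hst hst1 hts1 ⟨ha, hb⟩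
    have hs : s ∈ pathSet G a t := by change _ + _ = _; omega
    have ht : t ∈ pathSet G b s := by change _ + _ = _; omega
    refine hst ⟨(hT.mem_pathSet_or_mem_pathSet hs b).resolve_right ?_,
      pathSet_symm ((hT.mem_pathSet_or_mem_pathSet ht a).resolve_right ?_)⟩
    · intro h; change _ + _ = _ at h; omega
    · intro h; change _ + _ = _ at h; omega
  have h1 := hne a
  have h2 := hne b
  have h3 := hT.dist_triangle a u v
  have h4 := hT.dist_triangle a v u
  have h5 := hT.dist_triangle b u v
  have h6 := hT.dist_triangle b v u
  have h7 := not_opposite hoff huv hvu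
  have h8 := not_opposite (fun h => hoff h.symm) hvu huv
  omega

theorem dist_add_dist_of_mem_subtree (hT : IsDiscreteTree G) {a b u v : V}
    (h : v ∈ subtree G a b u) : G.dist a u + G.dist b v = G.dist a v + G.dist b u := by
  change Relation.ReflTransGen _ u v at h
  induction h with
  | refl => rfl
  | tail _ hedge ih =>
    have := hT.dist_add_dist_of_adj hedge.1 hedge.2
    omega

theorem exists_mem_pathSet_dist_eq_one (hT : IsDiscreteTree G) {z y : V} (hne : z ≠ y) :
    ∃ t ∈ pathSet G z y, G.dist t y = 1 := by
  obtain ⟨p, hp⟩ := hT.1.exists_walk_length_eq_dist y z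
  cases p with
  | nil => exact absurd rfl hne
  | @cons _ t _ hadj q =>
    have h1 := SimpleGraph.dist_eq_one_iff_adj.2 hadj.symm
    refine ⟨t, ?_, h1⟩
    have h2 := SimpleGraph.dist_le q
    have h3 := hT.dist_triangle z t y
    rw [SimpleGraph.Walk.length_cons, G.dist_comm] at hp
    rw [G.dist_comm] at h2
    change _ + _ = _
    omega

end IsDiscreteTree

namespace Strategyproof

variable {V : Type*} {n : ℕ} {G : SimpleGraph V} {f : (Fin n → V) → V}

theorem dist_update_le (hSP : Strategyproof G f) (a : Fin n → V) (j : Fin n) (p : V) :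
    G.dist p (f (update a j p)) ≤ G.dist p (f a) := by
  simpa using hSP (update a j p) j (a j)

theorem dist_piecewise_le (hSP : Strategyproof G f) (S : Finset (Fin n)) (a : Fin n → V) (p : V) :
    G.dist p (f (S.piecewise (fun _ => p) a)) ≤ G.dist p (f a) := by
  induction S using Finset.induction_on with
  | empty => simp
  | insert j S _ ih =>
    rw [Finset.piecewise_insert]
    exact (hSP.dist_update_le _ j p).trans ih

theorem unanimous (hSP : Strategyproof G f) (hG : G.Connected) (hOnto : Surjective f) (p : V) :
    f (fun _ => p) = p := by
  obtain ⟨a, ha⟩ := hOnto p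
  have h := hSP.dist_piecewise_le Finset.univ a p
  rw [Finset.piecewise_univ, ha, SimpleGraph.dist_self, Nat.le_zero] at h
  exact (hG.dist_eq_zero_iff.1 h).symm

/-- If every agent is at `t` or sees `t` strictly behind `z`, then an outcome adjacent to `t` on
the far side from `z` cannot be chosen. -/
theorem dist_lt_of_behind (hSP : Strategyproof G f) (hT : IsDiscreteTree G)
    (hOnto : Surjective f) {z t : V} (hzt : z ≠ t) {c : Fin n → V}
    (hc : ∀ j, c j = t ∨ z ∈ pathSet G (c j) t) (h1 : G.dist t (f c) ≤ 1) :
    G.dist z (f c) ≤ G.dist z t := by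
  by_contra! hlt
  have key : ∀ S : Finset (Fin n), G.dist z t < G.dist z (f (S.piecewise (fun _ => t) c)) := by
    intro S
    induction S using Finset.induction_on with
    | empty => simpa using hlt
    | insert j S hj ih =>
      have ho := (hSP.dist_piecewise_le S c t).trans h1
      rw [Finset.piecewise_insert]
      set e := S.piecewise (fun _ => t) c with he
      have hej : e j = c j := by simp [he, hj]
      rcases hc j with hjt | hjz
      · rwa [show t = e j from (hej.trans hjt).symm, update_eq_self, hej, hjt]
      · have hpos := hT.1.pos_dist_of_ne hzt
        have hle := hSP e j t
        have htri := hT.dist_triangle (c j) z (f (update e j t))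
        have htri' := hT.dist_triangle z t (f e)
        have hmem : t ∈ pathSet G z (f e) := by change _ + _ = _; omega
        rw [hej] at hle
        rcases hT.mem_pathSet_or_mem_pathSet hmem (c j) with h | h
        · change _ + _ = _ at h hjz
          rw [G.dist_comm (u := t), G.dist_comm (u := z) (v := c j)] at h
          omega
        · change _ + _ = _ at h hjz hmem
          omega
  have h := key Finset.univ
  rw [Finset.piecewise_univ, hSP.unanimous hT.1 hOnto] at h
  exact h.false

/-- If the agents of `K`, placed at `z`, get an outcome exactly as far from `z` as some outcome
`f c` they can reach, and all other agents see `f c` behind `z`, then this distance is at most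
`1`. -/
theorem dist_le_one_of_coalition (hSP : Strategyproof G f) (hT : IsDiscreteTree G)
    (hOnto : Surjective f) {K : Finset (Fin n)} {z : V} {a c : Fin n → V}
    (hac : ∀ j ∉ K, c j = a j) (hbehind : ∀ j ∉ K, z ∈ pathSet G (a j) (f c))
    (hdist : G.dist z (f (K.piecewise (fun _ => z) a)) = G.dist z (f c)) :
    G.dist z (f c) ≤ 1 := by
  by_contra! hk
  have hpw : ∀ (p : V) (e : Fin n → V), (∀ j ∉ K, e j = a j) →
      K.piecewise (fun _ => p) e = K.piecewise (fun _ => p) a := by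
    intro p e he
    ext j
    by_cases hj : j ∈ K <;> simp [hj, he]
  have hzy : z ≠ f c := by
    intro h
    rw [← h, SimpleGraph.dist_self] at hk
    omega
  obtain ⟨t, ht, hty⟩ := hT.exists_mem_pathSet_dist_eq_one hzy
  change _ + _ = _ at ht
  have hzt : z ≠ t := by
    intro h
    rw [← h, SimpleGraph.dist_self] at ht
    rw [← h] at hty
    omega
  have hfar := hSP.dist_piecewise_le K (K.piecewise (fun _ => t) a) z
  rw [hpw z _ (by intro j hj; simp [hj])] at hfar
  have hnear := hSP.dist_piecewise_le K c t
  rw [hpw t c hac, hty] at hnear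
  have := hSP.dist_lt_of_behind hT hOnto hzt (c := K.piecewise (fun _ => t) a) (fun j => by
    by_cases hj : j ∈ K
    · simp [hj]
    · right
      have h := hbehind j hj
      have h1 := hT.dist_triangle (a j) z t
      have h2 := hT.dist_triangle (a j) t (f c)
      change _ + _ = _ at h
      simp only [hj, not_false_eq_true, Finset.piecewise_eq_of_notMem]
      change _ + _ = _
      omega) hnear
  omega

end Strategyproof

/-- every onto, strategyproof mechanism on a discrete tree is
almost depth restricted (ADR). -/
theorem onto_sp_implies_adr {V : Type*} {n : ℕ} (G : SimpleGraph V)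
    (hT : IsDiscreteTree G) (f : (Fin n → V) → V)
    (hSP : Strategyproof G f) (hOnto : Function.Surjective f) :
    ADR G f := by
  intro a i b hne hsub z hz
  obtain ⟨⟨hAx, hAy⟩, hxy⟩ := hz
  have hSPab := hSP a i b
  have hSPba : G.dist b (f (update a i b)) ≤ G.dist b (f a) := hSP.dist_update_le a i b
  have hmem : f (update a i b) ∈ subtree G (a i) b (f a) := by
    rw [hsub]
    exact Relation.ReflTransGen.refl
  have hdepth := hT.dist_add_dist_of_mem_subtree hmem
  have hAx' : _ + _ = _ := hAx
  have hAy' : _ + _ = _ := hAy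
  have hxy' : _ + _ = _ := hxy
  have hpos := hT.1.pos_dist_of_ne hne
  have hxz := G.dist_comm (u := f a) (v := z)
  have hyz := G.dist_comm (u := f (update a i b)) (v := z)
  -- A maximal coalition containing `i` that, placed at `z`, keeps the outcome at the same distance.
  let P : Finset (Fin n) → Prop := fun K =>
    i ∈ K ∧ G.dist z (f (K.piecewise (fun _ => z) a)) = G.dist z (f a)
  have move : ∀ (e : Fin n → V) (j : Fin n), z ∈ pathSet G (e j) (f e) →
      G.dist z (f (update e j z)) = G.dist z (f e) := by
    intro e j hj
    have h1 := hSP.dist_update_le e j z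
    have h2 := hSP e j z
    have h3 := hT.dist_triangle (e j) z (f (update e j z))
    change _ + _ = _ at hj
    omega
  have hstart : P {i} := ⟨Finset.mem_singleton_self i, by
    rw [Finset.piecewise_singleton]; exact move a i hAx⟩
  obtain ⟨K, hK⟩ := (Set.toFinite {K | P K}).exists_maximal ⟨_, hstart⟩
  obtain ⟨⟨hiK, hKz⟩, hmax⟩ := hK
  set o := f (K.piecewise (fun _ => z) a)
  have hout : ∀ j ∉ K, z ∉ pathSet G (a j) o := by
    intro j hj hz
    refine hj (hmax (y := insert j K) ⟨Finset.mem_insert_of_mem hiK, ?_⟩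
      (Finset.subset_insert j K) (Finset.mem_insert_self j K))
    rw [Finset.piecewise_insert, move _ j (by simpa [hj] using hz)]
    exact hKz
  have hbehind : ∀ {y : V}, z ∈ pathSet G o y → ∀ j ∉ K, z ∈ pathSet G (a j) y := by
    intro y hy j hj
    refine (hT.mem_pathSet_or_mem_pathSet hy (a j)).resolve_left fun h => hout j hj ?_
    exact IsDiscreteTree.pathSet_symm h
  have hle : G.dist z (f a) ≤ 1 := by
    rcases hT.mem_pathSet_or_mem_pathSet hxy o with h | h
    · exact hSP.dist_le_one_of_coalition hT hOnto (fun _ _ => rfl)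
        (hbehind (IsDiscreteTree.pathSet_symm h)) hKz
    · have := hSP.dist_le_one_of_coalition hT hOnto (c := update a i b)
        (fun j hj => update_of_ne (ne_of_mem_of_not_mem hiK hj).symm b a) (hbehind h)
        (hKz.trans (by omega))
      omega
  omega
end

section
/- If an onto, strategyproof mechanism f on a discrete tree violates 1-TSI, then there exists a violating pair of profiles a, a' = (a_{-i}, a'_i) with d(a_i, a'_i) = 1; that is, a pair with d([a_i, a'_i], f(a)) > 1 and tree(a_i → a'_i, f(a)) ≠ tree(a_i → a'_i, f(a')) in which agent i moves to an adjacent vertex. -/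
open Function

/-- 1-tree step independent (1-TSI): if the facility is at distance more than 1
from the trajectory of the deviating agent, it stays in the same tree
w.r.t. the move. -/
def OneTSI {V : Type*} {n : ℕ} (G : SimpleGraph V) (f : (Fin n → V) → V) : Prop :=
  ∀ (a : Fin n → V) (i : Fin n) (b : V),
    distToSet G (f a) (pathSet G (a i) b) > 1 →
    subtree G (a i) b (f a) = subtree G (a i) b (f (Function.update a i b))

namespace SimpleGraph

variable {V : Type*} {G : SimpleGraph V}

theorem Connected.exists_adj_dist_add_one (hG : G.Connected) {p z : V} (h : p ≠ z) :
    ∃ q, G.Adj p q ∧ G.dist q z + 1 = G.dist p z := by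
  obtain ⟨w, hw⟩ := hG.exists_walk_length_eq_dist p z
  cases w with
  | nil => exact absurd rfl h
  | @cons _ q _ hpq w =>
    refine ⟨q, hpq, ?_⟩
    have h1 := dist_le w
    have h2 := hG.dist_triangle (u := p) (v := q) (w := z)
    rw [dist_eq_one_iff_adj.mpr hpq] at h2
    rw [Walk.length_cons] at hw
    omega

theorem IsTree.eq_of_adj_of_dist_add_one (hG : G.IsTree) {p v w z : V} (hv : G.Adj p v)
    (hw : G.Adj p w) (hvz : G.dist v z + 1 = G.dist p z) (hwz : G.dist w z + 1 = G.dist p z) :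
    v = w := by
  obtain ⟨r, hr⟩ := hG.connected.exists_walk_length_eq_dist v z
  obtain ⟨s, hs⟩ := hG.connected.exists_walk_length_eq_dist w z
  have h1 : (Walk.cons hv r).IsPath :=
    Walk.isPath_of_length_eq_dist _ (by rw [Walk.length_cons]; omega)
  have h2 : (Walk.cons hw s).IsPath :=
    Walk.isPath_of_length_eq_dist _ (by rw [Walk.length_cons]; omega)
  have h3 := congrArg Subtype.val ((hG.isAcyclic.subsingleton_path p z).elim ⟨_, h1⟩ ⟨_, h2⟩)
  simpa using congrArg Walk.snd h3

theorem IsTree.dist_add_one_or (hG : G.IsTree) {u v : V} (h : G.Adj u v) (z : V) :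
    G.dist u z + 1 = G.dist v z ∨ G.dist v z + 1 = G.dist u z := by
  have h0 := hG.dist_ne_of_adj z h
  have h1 := hG.connected.dist_triangle (u := u) (v := v) (w := z)
  have h2 := hG.connected.dist_triangle (u := v) (v := u) (w := z)
  rw [dist_eq_one_iff_adj.mpr h] at h1
  rw [dist_eq_one_iff_adj.mpr h.symm] at h2
  have := G.dist_comm (u := u) (v := z)
  have := G.dist_comm (u := v) (v := z)
  omega

/-- A geodesic whose first step leads away from `A` leads away from `A` throughout. -/
theorem IsTree.dist_eq_add_of_adj (hG : G.IsTree) {A p q z : V} (hpq : G.Adj p q)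
    (hqz : G.dist q z + 1 = G.dist p z) (hA : G.dist p A + 1 = G.dist q A) :
    G.dist z A = G.dist p A + G.dist p z := by
  induction h : G.dist q z generalizing p q with
  | zero =>
    obtain rfl := hG.connected.dist_eq_zero_iff.mp h
    omega
  | succ k ih =>
    have hne : q ≠ z := by
      rintro rfl
      simp at h
    obtain ⟨r, hqr, hrz⟩ := hG.connected.exists_adj_dist_add_one hne
    rcases hG.dist_add_one_or hqr A with h1 | h1
    · have := ih hqr hrz h1 (by omega)
      omega
    · obtain rfl := hG.eq_of_adj_of_dist_add_one hqr hpq.symm h1 hA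
      omega

end SimpleGraph

section

open SimpleGraph

variable {V : Type*} {G : SimpleGraph V}

/-- A vertex of `[x, y]` nearest to `A` separates `A` from `[x, y]`. -/
theorem dist_eq_add_of_nearest_pathSet (hG : G.IsTree) {x y A p z : V} (hp : p ∈ pathSet G x y)
    (hmin : ∀ q ∈ pathSet G x y, G.dist p A ≤ G.dist q A) (hz : z ∈ pathSet G x y) :
    G.dist z A = G.dist p A + G.dist p z := by
  by_cases hpz : p = z
  · subst hpz
    simp
  obtain ⟨q, hpq, hqz⟩ := hG.connected.exists_adj_dist_add_one hpz
  simp only [pathSet, Set.mem_ofPred_eq] at hp hz hmin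
  have hq : G.dist x q + G.dist q y = G.dist x y := by
    have ht := hG.connected.dist_triangle (u := x) (v := q) (w := y)
    have := G.dist_comm (u := x) (v := p)
    have := G.dist_comm (u := x) (v := q)
    have := G.dist_comm (u := x) (v := z)
    rcases hG.dist_add_one_or hpq x with h1 | h1 <;> rcases hG.dist_add_one_or hpq y with h2 | h2
    · have := hG.dist_eq_add_of_adj hpq hqz h1
      have := hG.dist_eq_add_of_adj hpq hqz h2
      omega
    all_goals omega
  have := hmin q hq
  exact hG.dist_eq_add_of_adj hpq hqz ((hG.dist_add_one_or hpq A).resolve_right (by omega))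

theorem mem_subtree_of_disjoint (hG : G.Connected) {x y A B : V}
    (h : Disjoint (pathSet G A B) (pathSet G x y)) : B ∈ subtree G x y A := by
  rw [Set.disjoint_left] at h
  simp only [subtree, Set.mem_ofPred_eq]
  induction hd : G.dist A B generalizing A with
  | zero => rw [hG.dist_eq_zero_iff.mp hd]
  | succ k ih =>
    have hne : A ≠ B := by
      rintro rfl
      simp at hd
    obtain ⟨q, hAq, hqB⟩ := hG.exists_adj_dist_add_one hne
    refine Relation.ReflTransGen.head ⟨hAq, fun hA => h (by simp [pathSet]) hA.1⟩
      (ih (fun z hz => h ?_) (by omega))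
    simp only [pathSet, Set.mem_ofPred_eq] at hz ⊢
    have h1 := hG.dist_triangle (u := A) (v := q) (w := z)
    have h2 := hG.dist_triangle (u := A) (v := z) (w := B)
    rw [dist_eq_one_iff_adj.mpr hAq] at h1
    omega

theorem subtree_eq_of_mem {x y A B : V} (h : B ∈ subtree G x y A) :
    subtree G x y A = subtree G x y B := by
  have hsymm : Std.Symm (fun s t =>
      G.Adj s t ∧ ¬(s ∈ pathSet G x y ∧ t ∈ pathSet G x y)) :=
    ⟨fun s t hst => ⟨hst.1.symm, fun hts => hst.2 hts.symm⟩⟩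
  ext z
  exact ⟨fun hz => (Relation.ReflTransGen.stdSymm.symm _ _ h).trans hz, fun hz => h.trans hz⟩

theorem mem_pathSet_of_adj (hG : G.Connected) {u v z : V} (h : G.Adj u v) :
    z ∈ pathSet G u v ↔ z = u ∨ z = v := by
  have h1 := dist_eq_one_iff_adj.mpr h
  constructor
  · intro hz
    simp only [pathSet, Set.mem_ofPred_eq] at hz
    rcases Nat.eq_zero_or_pos (G.dist u z) with h2 | h2
    · exact .inl (hG.dist_eq_zero_iff.mp h2).symm
    · exact .inr (hG.dist_eq_zero_iff.mp (by omega))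
  · rintro (rfl | rfl) <;> simp [pathSet]

/-- Deleting the edge `uv` separates the vertices closer to `u` from those closer to `v`. -/
theorem dist_lt_of_mem_subtree (hG : G.IsTree) {u v s t : V} (huv : G.Adj u v)
    (h : t ∈ subtree G u v s) (hs : G.dist s u < G.dist s v) : G.dist t u < G.dist t v := by
  induction h with
  | refl => exact hs
  | @tail x y _ hxy hx =>
    by_contra hy
    obtain ⟨hadj, hne⟩ := hxy
    rw [mem_pathSet_of_adj hG.connected huv, mem_pathSet_of_adj hG.connected huv] at hne
    have h1 := hG.dist_add_one_or huv x
    have h2 := hG.dist_add_one_or huv y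
    have h3 := hG.dist_add_one_or hadj u
    have h4 := hG.dist_add_one_or hadj v
    rw [G.dist_comm (u := u), G.dist_comm (u := v)] at h1 h2
    by_cases hyv : y = v
    · subst hyv
      rw [SimpleGraph.dist_self] at h2 h4
      exact hne ⟨.inl (hG.connected.dist_eq_zero_iff.mp (by omega)), .inr rfl⟩
    · obtain ⟨q, hyq, hqv⟩ := hG.connected.exists_adj_dist_add_one hyv
      have h5 := hG.dist_add_one_or hyq u
      have h6 := hG.dist_add_one_or huv q
      rw [G.dist_comm (u := u), G.dist_comm (u := v)] at h6
      obtain rfl := hG.eq_of_adj_of_dist_add_one (z := u) hyq hadj.symm (by omega) (by omega)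
      omega

/-- Moving along an edge away from the outcome, an agent without one-step violations keeps the
outcome on her old side of the edge. -/
theorem dist_add_one_of_no_edge_violation (hG : G.IsTree) {g : V → V}
    (hg : ∀ u v, G.Adj u v → distToSet G (g u) (pathSet G u v) > 1 →
      subtree G u v (g u) = subtree G u v (g v))
    {p v : V} (hpv : G.Adj p v) (h2 : 2 ≤ G.dist p (g p))
    (hv : G.dist p (g p) + 1 = G.dist v (g p)) : G.dist p (g v) + 1 = G.dist v (g v) := by
  have hd : distToSet G (g p) (pathSet G p v) > 1 := by
    obtain ⟨z, hz, hzd⟩ := Nat.sInf_mem (s := G.dist (g p) '' pathSet G p v)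
      ⟨_, p, (mem_pathSet_of_adj hG.connected hpv).mpr (.inl rfl), rfl⟩
    rw [distToSet, ← hzd, G.dist_comm]
    rcases (mem_pathSet_of_adj hG.connected hpv).mp hz with rfl | rfl <;> omega
  have hmem : g v ∈ subtree G p v (g p) := by
    rw [hg p v hpv hd]
    exact Relation.ReflTransGen.refl
  have hlt := dist_lt_of_mem_subtree hG hpv hmem
    (by rw [G.dist_comm, G.dist_comm (v := v)]; omega)
  rw [G.dist_comm, G.dist_comm (v := v)] at hlt
  have := hG.dist_add_one_or hpv (g v)
  omega

theorem nearest_of_adj (hG : G.IsTree) {g : V → V}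
    (hSP : ∀ u v, G.dist u (g u) ≤ G.dist u (g v))
    (hg : ∀ u v, G.Adj u v → distToSet G (g u) (pathSet G u v) > 1 →
      subtree G u v (g u) = subtree G u v (g v))
    {x p v : V} (h2 : 2 ≤ G.dist p (g x)) (hp : G.dist p (g p) = G.dist p (g x))
    (hpv : G.Adj p v) (hv : G.dist p (g x) + 1 = G.dist v (g x)) :
    G.dist v (g v) = G.dist v (g x) := by
  have hne : p ≠ g x := by
    intro h
    rw [← h, SimpleGraph.dist_self] at h2
    omega
  obtain ⟨q, hpq, hq⟩ := hG.connected.exists_adj_dist_add_one hne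
  have hqp : G.dist q (g p) + 1 = G.dist p (g p) := by
    by_contra hcon
    have h3 := dist_add_one_of_no_edge_violation hG hg hpq (by omega)
      ((hG.dist_add_one_or hpq (g p)).resolve_right hcon)
    have := hSP q x
    have := hSP p q
    omega
  have hvp : G.dist p (g p) + 1 = G.dist v (g p) := by
    refine (hG.dist_add_one_or hpv (g p)).resolve_right fun hcon => ?_
    obtain rfl := hG.eq_of_adj_of_dist_add_one hpq hpv hqp hcon
    omega
  have h3 := dist_add_one_of_no_edge_violation hG hg hpv (by omega) hvp
  have := hSP p v
  have := hSP v x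
  omega

/-- Without one-step violations, an outcome that is nearest to a vertex `p` at distance at least
two stays nearest along every geodesic leading away from it through `p`. -/
theorem nearest_of_dist_eq_add (hG : G.IsTree) {g : V → V}
    (hSP : ∀ u v, G.dist u (g u) ≤ G.dist u (g v))
    (hg : ∀ u v, G.Adj u v → distToSet G (g u) (pathSet G u v) > 1 →
      subtree G u v (g u) = subtree G u v (g v))
    {x p z : V} (h2 : 2 ≤ G.dist p (g x)) (hp : G.dist p (g p) = G.dist p (g x))
    (hz : G.dist z (g x) = G.dist p (g x) + G.dist p z) :
    G.dist z (g z) = G.dist z (g x) := by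
  induction hd : G.dist p z generalizing p with
  | zero => rwa [← hG.connected.dist_eq_zero_iff.mp hd]
  | succ k ih =>
    have hne : p ≠ z := by
      rintro rfl
      simp at hd
    obtain ⟨q, hpq, hqz⟩ := hG.connected.exists_adj_dist_add_one hne
    have hq : G.dist p (g x) + 1 = G.dist q (g x) := by
      have := hG.connected.dist_triangle (u := z) (v := q) (w := g x)
      rw [G.dist_comm (u := z) (v := q)] at this
      have := hG.dist_add_one_or hpq (g x)
      omega
    exact ih (by omega) (nearest_of_adj hG hSP hg h2 hp hpq hq) (by omega) (by omega)

theorem subtree_eq_of_no_edge_violation (hG : G.IsTree) {g : V → V}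
    (hSP : ∀ u v, G.dist u (g u) ≤ G.dist u (g v))
    (hg : ∀ u v, G.Adj u v → distToSet G (g u) (pathSet G u v) > 1 →
      subtree G u v (g u) = subtree G u v (g v))
    {x y : V} (h : distToSet G (g x) (pathSet G x y) > 1) :
    subtree G x y (g x) = subtree G x y (g y) := by
  have hx : x ∈ pathSet G x y := by simp [pathSet]
  obtain ⟨p, hp, hpd⟩ := Nat.sInf_mem (s := G.dist (g x) '' pathSet G x y) ⟨_, x, hx, rfl⟩
  have hmin : ∀ q ∈ pathSet G x y, G.dist p (g x) ≤ G.dist q (g x) := by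
    intro q hq
    rw [G.dist_comm, hpd, G.dist_comm]
    exact Nat.sInf_le ⟨q, hq, rfl⟩
  rw [distToSet, ← hpd, G.dist_comm] at h
  refine subtree_eq_of_mem (mem_subtree_of_disjoint hG.connected ?_)
  rw [Set.disjoint_left]
  intro z hz hzxy
  simp only [pathSet, Set.mem_ofPred_eq] at hz
  have h1 := dist_eq_add_of_nearest_pathSet hG hp hmin hzxy
  have h2 := dist_eq_add_of_nearest_pathSet hG hp hmin hx
  have hnear : G.dist p (g p) = G.dist p (g x) := by
    have := hG.connected.dist_triangle (u := x) (v := p) (w := g p)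
    rw [G.dist_comm (u := x) (v := p)] at this
    have := hSP x p
    have := hSP p x
    omega
  have hy : G.dist (g y) (g x) = G.dist p (g x) + G.dist p (g y) := by
    have h3 := hG.connected.dist_triangle (u := p) (v := z) (w := g y)
    have h4 := hG.connected.dist_triangle (u := g y) (v := p) (w := g x)
    rw [G.dist_comm (u := g y) (v := p)] at h4
    rw [G.dist_comm (u := g x) (v := z), G.dist_comm (u := g x) (v := g y)] at hz
    omega
  have h5 := nearest_of_dist_eq_add hG hSP hg (by omega) hnear hy
  have h6 := hSP (g y) y
  rw [SimpleGraph.dist_self] at h6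
  omega

end

/-- if an onto, strategyproof mechanism on a discrete tree
violates 1-TSI, then some violating pair has the deviating agent moving to an
adjacent vertex. -/
theorem tsi_violation_one_step {V : Type*} {n : ℕ} (G : SimpleGraph V)
    (hT : IsDiscreteTree G) (f : (Fin n → V) → V)
    (hSP : Strategyproof G f) (hOnto : Function.Surjective f)
    (hviol : ¬ OneTSI G f) :
    ∃ (a : Fin n → V) (i : Fin n) (b : V),
      distToSet G (f a) (pathSet G (a i) b) > 1 ∧
      subtree G (a i) b (f a) ≠ subtree G (a i) b (f (Function.update a i b)) ∧
      G.dist (a i) b = 1 := by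
  have hG : G.IsTree := ⟨hT.1, hT.2.1⟩
  by_contra hcon
  push Not at hcon
  refine hviol fun a i b h => ?_
  have key := subtree_eq_of_no_edge_violation hG (g := fun x => f (Function.update a i x))
    (fun u v => by simpa using hSP (Function.update a i u) i v)
    (fun u v huv hd => by
      by_contra hne
      refine hcon (Function.update a i u) i v ?_ ?_ ?_
      · simpa using hd
      · simpa using hne
      · simpa using SimpleGraph.dist_eq_one_iff_adj.mpr huv)
    (x := a i) (y := b)
  simp only [Function.update_eq_self] at key
  exact key h
end

section
/- If a mechanism f : ℤ^n → ℤ on the infinite discrete line is onto, strategyproof, and shift-invariant, then for every profile a = (a_1, ..., a_n), it holds that f(a) = a_i for some agent i (f is tops-only: the outcome is always one of the reported locations). -/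
open Function

/-- A mechanism on the infinite discrete line (vertex set `ℤ`, graph distance
`|x - y|`) is strategyproof if no agent can get the facility strictly closer
to her true location by misreporting. -/
def StrategyproofZ {n : ℕ} (f : (Fin n → ℤ) → ℤ) : Prop :=
  ∀ (a : Fin n → ℤ) (i : Fin n) (b : ℤ),
    |a i - f a| ≤ |a i - f (Function.update a i b)|

/-- Shift-invariance: translating all reports by `d` translates the outcome by `d`. -/
def ShiftInvariant {n : ℕ} (f : (Fin n → ℤ) → ℤ) : Prop :=
  ∀ (a : Fin n → ℤ) (d : ℤ), f (fun j => a j + d) = f a + d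

/-- Anonymity: the outcome is invariant under permutations of the agents. -/
def AnonymousZ {n : ℕ} (f : (Fin n → ℤ) → ℤ) : Prop :=
  ∀ (a : Fin n → ℤ) (π : Equiv.Perm (Fin n)), f (a ∘ π) = f a

/-- If one agent moves to the current outcome, or to the neighbour of the outcome on her own side,
the outcome of a strategyproof mechanism does not change. -/
theorem StrategyproofZ.update_eq {n : ℕ} {f : (Fin n → ℤ) → ℤ} (hSP : StrategyproofZ f)
    (c : Fin n → ℤ) (i : Fin n) (v : ℤ)
    (hv : v = f c ∨ (c i < f c ∧ v = f c - 1) ∨ (f c < c i ∧ v = f c + 1)) :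
    f (update c i v) = f c := by
  have h₁ := hSP c i v
  have h₂ := hSP (update c i v) i (c i)
  simp only [update_self, update_idem, update_eq_self] at h₂
  rcases eq_or_ne (c i) v with rfl | hne
  · rw [update_eq_self]
  · grind

/-- The same invariance when all agents move simultaneously. -/
theorem StrategyproofZ.eq_of_forall_toward {n : ℕ} {f : (Fin n → ℤ) → ℤ} (hSP : StrategyproofZ f)
    (a v : Fin n → ℤ)
    (hv : ∀ i, v i = f a ∨ (a i < f a ∧ v i = f a - 1) ∨ (f a < a i ∧ v i = f a + 1)) :
    f v = f a := by
  have key : ∀ s : Finset (Fin n), f (s.piecewise v a) = f a := by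
    intro s
    induction s using Finset.induction_on with
    | empty => simp
    | insert i s hi ih =>
      rw [Finset.piecewise_insert, hSP.update_eq, ih]
      simpa only [ih, Finset.piecewise_eq_of_notMem s v a hi] using hv i
  simpa using key Finset.univ

/-- every onto, strategyproof, shift-invariant mechanism on the
infinite discrete line always outputs one of the reported locations. -/
theorem onto_sp_shift_invariant_tops_only {n : ℕ} (f : (Fin n → ℤ) → ℤ)
    (hOnto : Function.Surjective f) (hSP : StrategyproofZ f)
    (hShift : ShiftInvariant f) :
    ∀ a : Fin n → ℤ, ∃ i : Fin n, f a = a i := by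
  intro a
  by_contra! hne
  have h₁ := hSP.eq_of_forall_toward a (fun i => if a i < f a then f a - 1 else f a)
    (fun i => by grind)
  have h₂ := hSP.eq_of_forall_toward a
    (fun i => (if a i < f a then f a - 1 else f a) + 1) (fun i => by grind)
  have h₃ := hShift (fun i => if a i < f a then f a - 1 else f a) 1
  omega
end

section
/- Every onto, strategyproof, anonymous, and shift-invariant mechanism f : ℤ^n → ℤ on the infinite discrete line is a k-th order statistic mechanism for some k ∈ {1, ..., n}: for every profile a, f(a) equals the k-th smallest value among a_1, ..., a_n. -/
open Function

/-- A strategyproof mechanism is monotone in the report of each single agent. -/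
theorem StrategyproofZ.le_update {n : ℕ} {f : (Fin n → ℤ) → ℤ} (hSP : StrategyproofZ f)
    (a : Fin n → ℤ) (i : Fin n) {c : ℤ} (hc : a i ≤ c) : f a ≤ f (update a i c) := by
  rcases hc.eq_or_lt with rfl | hlt
  · simp
  have h₁ := hSP a i c
  have h₂ := hSP (update a i c) i (a i)
  simp only [update_self, update_idem, update_eq_self] at h₂
  grind

/-- A property of profiles that survives replacing the reports of `a` by those of `b`, one agent
at a time, passes from `a` to `b`. -/
theorem forall_update_induction {n : ℕ} {P : (Fin n → ℤ) → Prop} {a b : Fin n → ℤ}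
    (hstep : ∀ (c : Fin n → ℤ) (i : Fin n), c i = a i → P c → P (update c i (b i)))
    (ha : P a) : P b := by
  have key : ∀ s : Finset (Fin n), P (s.piecewise b a) := by
    intro s
    induction s using Finset.induction_on with
    | empty => simpa using ha
    | insert i s hi ih =>
      rw [Finset.piecewise_insert]
      exact hstep _ i (Finset.piecewise_eq_of_notMem _ _ _ hi) ih
  simpa using key Finset.univ

theorem StrategyproofZ.monotone {n : ℕ} {f : (Fin n → ℤ) → ℤ} (hSP : StrategyproofZ f) :
    Monotone f := fun a _ hab =>
  forall_update_induction (P := fun c => f a ≤ f c)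
    (fun c i hci h => h.trans (hSP.le_update c i (hci.trans_le (hab i)))) le_rfl

/-- Raising one report by `1` raises the outcome by at most `1`. -/
theorem StrategyproofZ.update_add_one_le {n : ℕ} {f : (Fin n → ℤ) → ℤ} (hSP : StrategyproofZ f)
    (hShift : ShiftInvariant f) (a : Fin n → ℤ) (i : Fin n) (t : ℤ) :
    f (update a i (t + 1)) ≤ f (update a i t) + 1 := by
  rw [← hShift]
  refine hSP.monotone fun j => ?_
  by_cases hj : j = i
  · subst hj; simp
  · simp [hj]

/-- An integer function with upward steps at most `1` attains `x - 1` and then `x` when passing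
from below `x` to at least `x`. -/
theorem exists_crossing_of_step_le_one {g : ℤ → ℤ} (hg : ∀ t, g (t + 1) ≤ g t + 1) {x c e : ℤ}
    (hce : c ≤ e) (hc : g c < x) (he : x ≤ g e) : ∃ d, g d = x - 1 ∧ g (d + 1) = x := by
  by_contra! hno
  have key : ∀ t, c ≤ t → g t < x := by
    intro t ht
    induction t, ht using Int.leInduction with
    | base => exact hc
    | succ t _ ih =>
      have h₁ := hg t
      have h₂ := hno t
      grind
  exact (key e hce).not_ge he

theorem StrategyproofZ.le_apply_update {n : ℕ} {f : (Fin n → ℤ) → ℤ} (hSP : StrategyproofZ f)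
    (hShift : ShiftInvariant f) (a : Fin n → ℤ) (i : Fin n) {x c : ℤ} (hc : x ≤ a i → x ≤ c)
    (hx : x ≤ f a) : x ≤ f (update a i c) := by
  by_contra! hlt
  have hca : c ≤ a i := by
    by_contra! h
    exact (hx.trans (hSP.le_update a i h.le)).not_gt hlt
  obtain ⟨d, hd₁, hd₂⟩ := exists_crossing_of_step_le_one
    (g := fun t => f (update a i t)) (hSP.update_add_one_le hShift a i) hca hlt (by simpa using hx)
  have h₁ := hSP a i d
  have h₂ := hSP (update a i c) i (d + 1)
  simp only [update_self, update_idem] at h₂ hd₁ hd₂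
  grind

/-- Whether the outcome is at least `x` depends monotonically on the set of agents whose report is
at least `x`, uniformly in the threshold. -/
theorem StrategyproofZ.le_apply_of_imp {n : ℕ} {f : (Fin n → ℤ) → ℤ} (hSP : StrategyproofZ f)
    (hShift : ShiftInvariant f) {a b : Fin n → ℤ} {x y : ℤ} (hab : ∀ i, x ≤ a i → y ≤ b i)
    (hx : x ≤ f a) : y ≤ f b := by
  have key : x ≤ f (fun i => b i + (x - y)) :=
    forall_update_induction (P := fun c => x ≤ f c)
      (fun c i hci h => hSP.le_apply_update hShift c i
        (fun hxi => by have := hab i (hci ▸ hxi); lia) h) hx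
  rw [hShift] at key
  lia

/-- An onto strategyproof mechanism is unanimous at `0`. -/
theorem StrategyproofZ.apply_zero {n : ℕ} {f : (Fin n → ℤ) → ℤ} (hSP : StrategyproofZ f)
    (hOnto : Surjective f) : f (fun _ => 0) = 0 := by
  obtain ⟨a, ha⟩ := hOnto 0
  refine forall_update_induction (P := fun c => f c = 0) (fun c i _ h => ?_) ha
  have := hSP (update c i 0) i (c i)
  simpa [h] using this

/-- every onto, strategyproof, anonymous, shift-invariant
mechanism on the infinite discrete line is a k-th order statistic mechanism:
it always outputs the k-th smallest reported location. -/
theorem onto_sp_anon_shift_invariant_order_statistic {n : ℕ}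
    (f : (Fin n → ℤ) → ℤ)
    (hOnto : Function.Surjective f) (hSP : StrategyproofZ f)
    (hAnon : AnonymousZ f) (hShift : ShiftInvariant f) :
    ∃ k : Fin n, ∀ a : Fin n → ℤ, f a = a (Tuple.sort a k) := by
  let e : ℕ → Fin n → ℤ := fun m j => if m ≤ (j : ℕ) then 1 else 0
  have hzero := hSP.apply_zero hOnto
  have he₀ : 1 ≤ f (e 0) := by
    have h := hShift (fun _ => 0) 1
    simp only [hzero, zero_add] at h
    simp [e, h]
  have heₙ : ¬ 1 ≤ f (e n) := by
    have h : e n = fun _ => 0 := by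
      funext j
      simp [e]
    simp [h, hzero]
  obtain ⟨m, hmn, hm, hm'⟩ : ∃ m < n, 1 ≤ f (e m) ∧ ¬ 1 ≤ f (e (m + 1)) := by
    by_contra! hno
    have key : ∀ m ≤ n, 1 ≤ f (e m) := by
      intro m
      induction m with
      | zero => exact fun _ => he₀
      | succ m ih => exact fun h => hno m h (ih (by lia))
    exact heₙ (key n le_rfl)
  refine ⟨⟨m, hmn⟩, fun a => ?_⟩
  have hmono := Tuple.monotone_sort a
  rw [← hAnon a (Tuple.sort a)]
  refine eq_of_forall_le_iff fun x => ⟨fun hx => ?_, fun hx => ?_⟩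
  · by_contra! hlt
    refine hm' (hSP.le_apply_of_imp hShift (fun j hj => ?_) hx)
    have hmj : m < (j : ℕ) := by
      by_contra! hjm
      exact (hj.trans (hmono (show j ≤ ⟨m, hmn⟩ from hjm))).not_gt hlt
    simp [e, Nat.succ_le_of_lt hmj]
  · refine hSP.le_apply_of_imp hShift (fun j hj => ?_) hm
    have hmj : m ≤ (j : ℕ) := by
      by_contra! hjm
      simp [e, hjm.not_ge] at hj
    exact hx.trans (hmono (show ⟨m, hmn⟩ ≤ j from hmj))
end

section
/- An onto mechanism f : ℤ^n → ℤ on the infinite discrete line is anonymous, shift-invariant, and strategyproof if and only if f is a k-th order statistic mechanism for some k ∈ {1, ..., n}, i.e., for every profile a, f(a) equals the k-th smallest value among a_1, ..., a_n. -/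
open Function

/-- Moving every report towards the outcome, without crossing it, leaves the outcome unchanged. -/
theorem StrategyproofZ.apply_eq_of_mem_uIcc {n : ℕ} {f : (Fin n → ℤ) → ℤ}
    (hf : StrategyproofZ f) {a b : Fin n → ℤ} (h : ∀ i, b i ∈ Set.uIcc (a i) (f a)) :
    f b = f a := by
  classical
  suffices H : ∀ s : Finset (Fin n), f (s.piecewise b a) = f a by
    simpa using H Finset.univ
  intro s
  induction s using Finset.induction_on with
  | empty => simp
  | insert i s his ih =>
    rw [Finset.piecewise_insert]
    set c := s.piecewise b a with hc
    have hci : c i = a i := by simp [hc, his]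
    have h₁ := hf c i (b i)
    have h₂ := hf (Function.update c i (b i)) i (c i)
    simp only [Function.update_self, Function.update_idem, Function.update_eq_self] at h₂
    have h₃ := Set.mem_uIcc.mp (h i)
    rw [ih, hci] at h₁
    rw [ih] at h₂
    by_cases hab : b i = a i
    · rw [hab, ← hci, Function.update_eq_self, ih]
    · generalize f (Function.update c i (b i)) = z at *
      grind

/-- Strategyproof onto mechanisms are unanimous. -/
theorem StrategyproofZ.apply_const {n : ℕ} {f : (Fin n → ℤ) → ℤ}
    (hf : StrategyproofZ f) (hOnto : Function.Surjective f) (c : ℤ) :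
    f (fun _ => c) = c := by
  obtain ⟨a, rfl⟩ := hOnto c
  exact hf.apply_eq_of_mem_uIcc fun i => Set.right_mem_uIcc

/-- The `k`-th order statistic is at most `y` iff more than `k` entries are at most `y`. -/
theorem apply_sort_le_iff {n : ℕ} (a : Fin n → ℤ) (k : Fin n) (y : ℤ) :
    a (Tuple.sort a k) ≤ y ↔ (k : ℕ) < Fintype.card {i // a i ≤ y} := by
  have h := Tuple.lt_card_le_iff_apply_le_of_monotone (f := a ∘ Tuple.sort a) (a := y)
    (j := k) (Tuple.monotone_sort a)
  have e : Fintype.card {i // (a ∘ Tuple.sort a) i ≤ y} = Fintype.card {i // a i ≤ y} :=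
    Fintype.card_congr ((Tuple.sort a).subtypeEquiv fun _ => Iff.rfl)
  rw [← e, Fintype.card_subtype]
  exact h.symm

theorem apply_sort_le_of_imp {n : ℕ} {a b : Fin n → ℤ} {k : Fin n} {y : ℤ}
    (hab : ∀ i, a i ≤ y → b i ≤ y) (h : a (Tuple.sort a k) ≤ y) :
    b (Tuple.sort b k) ≤ y := by
  rw [apply_sort_le_iff] at h ⊢
  exact h.trans_le (Fintype.card_subtype_mono _ _ hab)

theorem anonymousZ_apply_sort {n : ℕ} (k : Fin n) :
    AnonymousZ fun a => a (Tuple.sort a k) := fun _ _ =>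
  congrFun Tuple.comp_perm_comp_sort_eq_comp_sort k

theorem shiftInvariant_apply_sort {n : ℕ} (k : Fin n) :
    ShiftInvariant fun a => a (Tuple.sort a k) := by
  intro a d
  have h : Monotone ((fun j => a j + d) ∘ Tuple.sort a) := fun i j hij =>
    add_le_add_left (Tuple.monotone_sort a hij) d
  exact (congrFun (Tuple.comp_sort_eq_comp_iff_monotone.mpr h) k).symm

theorem strategyproofZ_apply_sort {n : ℕ} (k : Fin n) :
    StrategyproofZ fun a => a (Tuple.sort a k) := by
  intro a i b
  change |a i - a (Tuple.sort a k)| ≤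
    |a i - Function.update a i b (Tuple.sort (Function.update a i b) k)|
  have hne : ∀ j, j ≠ i → Function.update a i b j = a j := fun j hj =>
    Function.update_of_ne hj b a
  generalize Function.update a i b = c at hne ⊢
  rcases lt_trichotomy (a i) (a (Tuple.sort a k)) with hlt | heq | hgt
  · have h : a (Tuple.sort a k) ≤ c (Tuple.sort c k) := by
      by_contra! hc
      have := apply_sort_le_of_imp (b := a) (y := a (Tuple.sort a k) - 1)
        (fun j hj => by
          by_cases hji : j = i
          · subst hji
            omega
          · rwa [← hne j hji]) (Int.le_sub_one_of_lt hc)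
      omega
    rw [abs_of_neg (by omega), abs_of_neg (by omega)]
    omega
  · simp [← heq]
  · have h : c (Tuple.sort c k) ≤ a (Tuple.sort a k) :=
      apply_sort_le_of_imp (fun j hj => by
        rwa [hne j (by rintro rfl; omega)]) le_rfl
    rw [abs_of_pos (by omega), abs_of_pos (by omega)]
    omega

/-- A strategyproof, anonymous, shift-invariant onto mechanism is an order statistic. -/
theorem StrategyproofZ.exists_eq_apply_sort {n : ℕ} {f : (Fin n → ℤ) → ℤ}
    (hf : StrategyproofZ f) (hOnto : Function.Surjective f) (hA : AnonymousZ f)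
    (hS : ShiftInvariant f) :
    ∃ k : Fin n, ∀ a : Fin n → ℤ, f a = a (Tuple.sort a k) := by
  classical
  let E : ℕ → Fin n → ℤ := fun j i => if j ≤ i then 1 else 0
  have hE0 : f (E 0) = 1 := by simpa [E] using hf.apply_const hOnto 1
  have hEn : f (E n) ≠ 1 := by
    have : E n = fun _ => 0 := by
      funext i
      simp [E]
    rw [this, hf.apply_const hOnto 0]
    decide
  obtain ⟨k, hkn, hk, hk_succ⟩ : ∃ k, k < n ∧ f (E k) = 1 ∧ f (E (k + 1)) ≠ 1 := by
    by_contra! H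
    have : ∀ j ≤ n, f (E j) = 1 := by
      intro j
      induction j with
      | zero => exact fun _ => hE0
      | succ j ih => exact fun hj => H j hj (ih (by omega))
    exact hEn (this n le_rfl)
  refine ⟨⟨k, hkn⟩, fun a => ?_⟩
  rw [← hA a (Tuple.sort a)]
  change _ = (a ∘ Tuple.sort a) ⟨k, hkn⟩
  have hmono : Monotone (a ∘ Tuple.sort a) := Tuple.monotone_sort a
  generalize a ∘ Tuple.sort a = s at hmono ⊢
  rcases lt_trichotomy (f s) (s ⟨k, hkn⟩) with hlt | heq | hgt
  · have h : f (fun i => E k i + f s) = f s := hf.apply_eq_of_mem_uIcc fun i => by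
      rw [Set.mem_uIcc]
      by_cases hi : k ≤ i
      · have := hmono (show (⟨k, hkn⟩ : Fin n) ≤ i from hi)
        simp only [E, hi, if_true]
        omega
      · simp only [E, hi, if_false]
        omega
    rw [hS, hk] at h
    omega
  · exact heq
  · have h : f (fun i => E (k + 1) i + (f s - 1)) = f s := hf.apply_eq_of_mem_uIcc fun i => by
      rw [Set.mem_uIcc]
      by_cases hi : k + 1 ≤ i
      · simp only [E, hi, if_true]
        omega
      · have := hmono (show i ≤ (⟨k, hkn⟩ : Fin n) from Fin.le_def.mpr (by simp; omega))
        simp only [E, hi, if_false]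
        omega
    rw [hS] at h
    exact absurd (by omega) hk_succ

/-- an onto mechanism on the infinite discrete line is anonymous,
shift-invariant, and strategyproof iff it is a k-th order statistic mechanism
for some k. -/
theorem onto_anon_shift_sp_iff_order_statistic {n : ℕ}
    (f : (Fin n → ℤ) → ℤ) (hOnto : Function.Surjective f) :
    (AnonymousZ f ∧ ShiftInvariant f ∧ StrategyproofZ f) ↔
      (∃ k : Fin n, ∀ a : Fin n → ℤ, f a = a (Tuple.sort a k)) := by
  constructor
  · rintro ⟨hA, hS, hf⟩
    exact hf.exists_eq_apply_sort hOnto hA hS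
  · rintro ⟨k, hk⟩
    obtain rfl : f = fun a => a (Tuple.sort a k) := funext hk
    exact ⟨anonymousZ_apply_sort k, shiftInvariant_apply_sort k, strategyproofZ_apply_sort k⟩
end

section
/- On the 5-vertex discrete tree T with vertex set {0, 1, 2, 3, 4} and edges {0,2}, {1,2}, {2,3}, {3,4}, define the 2-agent mechanism f(x, y) = x mod 2 if y = 0; f(x, y) = min(x, 3) if y = 2; and f(x, y) = min(x, y) otherwise. Then f is strategyproof (with respect to graph distance on T) and onto; moreover, for the profiles a = (0, 3) and a' = (0, 4), f(a) = 1 and f(a') = 0, so the facility moves even though the path [f(a), f(a')] = {1, 2, 0} intersects the moving agent's path [3, 4] in no vertex — exhibiting that the facility's trajectory need not intersect the agent's trajectory in at least two consecutive vertices. -/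
open Function

/-- The 5-vertex discrete tree on `{0,1,2,3,4}`: vertices `0` and `1` are each
adjacent to `2`, and `2 – 3 – 4` is a path. -/
def G17 : SimpleGraph (Fin 5) :=
  SimpleGraph.fromRel (fun u w =>
    (u = 0 ∧ w = 2) ∨ (u = 1 ∧ w = 2) ∨ (u = 2 ∧ w = 3) ∨ (u = 3 ∧ w = 4))

/-- The 2-agent mechanism of Fig. 1 of the paper.  The first argument is the
location of agent 1 (the agent checked against `0` and `2`, located at vertex
`0` in the example) and the second argument is the location of agent 2 (the
agent ranging over the tree, called `x` in the paper's algorithm):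
if agent 1 reports `0` the outcome is (agent 2's report) mod 2; if agent 1
reports `2` the outcome is `min`(agent 2's report, 3); otherwise the outcome is
the minimum of the two reports. -/
def f17 (x y : Fin 5) : Fin 5 :=
  if x = 0 then ⟨y.val % 2, by omega⟩
  else if x = 2 then min y 3
  else min x y

/-- A function vanishing at `u`, growing by at most one along each edge, and decreasing by one
along some edge at each vertex other than `u`, is the distance from `u`. -/
theorem SimpleGraph.dist_eq_of_forall_adj {V : Type*} {G : SimpleGraph V} {u : V} {d : V → ℕ}
    (hu : d u = 0) (hle : ∀ v w, G.Adj v w → d w ≤ d v + 1)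
    (hpred : ∀ v, v ≠ u → ∃ w, G.Adj w v ∧ d v = d w + 1) (v : V) :
    G.dist u v = d v := by
  have hwalk : ∀ {a b : V} (p : G.Walk a b), d b ≤ d a + p.length := by
    intro a b p
    induction p with
    | nil => simp
    | cons h p ih =>
      have := hle _ _ h
      rw [SimpleGraph.Walk.length_cons]
      omega
  have hex : ∀ n v, d v = n → ∃ p : G.Walk u v, p.length = n := by
    intro n
    induction n with
    | zero =>
      intro v hv
      by_cases h : v = u
      · subst h
        exact ⟨.nil, rfl⟩
      · obtain ⟨w, -, hw⟩ := hpred v h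
        omega
    | succ n ih =>
      intro v hv
      obtain ⟨w, hadj, hw⟩ := hpred v (by rintro rfl; omega)
      obtain ⟨p, hp⟩ := ih w (by omega)
      exact ⟨p.concat hadj, by rw [SimpleGraph.Walk.length_concat, hp]⟩
  obtain ⟨p, hp⟩ := hex _ v rfl
  refine le_antisymm (hp ▸ SimpleGraph.dist_le p) ?_
  obtain ⟨q, hq⟩ := p.reachable.exists_walk_length_eq_dist
  have := hwalk q
  omega

instance : DecidableRel G17.Adj :=
  fun u w => decidable_of_iff _ (SimpleGraph.fromRel_adj _ u w).symm

/-- The distance matrix of `G17`. -/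
def distG17 : Matrix (Fin 5) (Fin 5) ℕ :=
  !![0, 2, 1, 2, 3;
     2, 0, 1, 2, 3;
     1, 1, 0, 1, 2;
     2, 2, 1, 0, 1;
     3, 3, 2, 1, 0]

theorem dist_G17 (u v : Fin 5) : G17.dist u v = distG17 u v := by
  refine SimpleGraph.dist_eq_of_forall_adj ?_ ?_ ?_ v <;> revert u <;> decide

theorem mem_pathSet_G17 {u w v : Fin 5} :
    v ∈ pathSet G17 u w ↔ distG17 u v + distG17 v w = distG17 u w := by
  simp only [pathSet, Set.mem_ofPred_eq, dist_G17]

/-- the mechanism `f17` on the 5-vertex tree `G17` is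
strategyproof (for both agents, w.r.t. graph distance) and onto; moreover for
the profiles `a = (0,3)` and `a' = (0,4)` we have `f(a) = 1` and `f(a') = 0`,
the path `[f(a), f(a')]` is `{0,1,2}`, and it intersects the moving agent's
path `[3,4]` in no vertex. -/
theorem f17_sp_onto_counterexample :
    (∀ x x' y : Fin 5, G17.dist x (f17 x y) ≤ G17.dist x (f17 x' y)) ∧
    (∀ x y y' : Fin 5, G17.dist y (f17 x y) ≤ G17.dist y (f17 x y')) ∧
    (∀ v : Fin 5, ∃ x y : Fin 5, f17 x y = v) ∧
    f17 0 3 = 1 ∧ f17 0 4 = 0 ∧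
    pathSet G17 (f17 0 3) (f17 0 4) = {0, 1, 2} ∧
    pathSet G17 (f17 0 3) (f17 0 4) ∩ pathSet G17 3 4 = ∅ := by
  simp only [dist_G17, Set.ext_iff, Set.mem_inter_iff, mem_pathSet_G17, Set.mem_insert_iff,
    Set.mem_singleton_iff, Set.mem_empty_iff_false]
  decide
end
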